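/- Let k be an algebraically closed field of odd characteristic p, and let f ∈ k[x,y,z] be a homogeneous polynomial of degree 3 such that f and its three partial derivatives ∂f/∂x, ∂f/∂y, ∂f/∂z have no common zero in k³ other than (0,0,0) (so f defines a smooth plane elliptic curve). Then for every power q = pⁿ of p (n ≥ 0), dim_k k[x,y,z]/(f, x^q, y^q, z^q) = (9q² − 5)/4. -/

import Mathlib

open MvPolynomial

section Graded

variable {σ R : Type*} [CommRing R]

lemma homogeneousComponent_add_mul_of_isHomogeneous {d : ℕ} {w : MvPolynomial σ R}
    (hw : w.IsHomogeneous d) (n : ℕ) (p : MvPolynomial σ R) :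
    homogeneousComponent (d + n) (w * p) = w * homogeneousComponent n p := by
  conv_lhs => rw [← sum_homogeneousComponent p, Finset.mul_sum, map_sum]
  have h : ∀ i, homogeneousComponent (d + n) (w * homogeneousComponent i p) =
      if i = n then w * homogeneousComponent n p else 0 := by
    intro i
    rw [homogeneousComponent_of_mem (hw.mul (homogeneousComponent_isHomogeneous i p))]
    by_cases hi : i = n
    · simp [hi]
    · rw [if_neg (by omega), if_neg hi]
  simp only [h, Finset.sum_ite_eq', Finset.mem_range]
  split_ifs with hn
  · rfl
  · rw [homogeneousComponent_eq_zero _ _ (by omega), mul_zero]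

lemma homogeneousComponent_mul_of_lt {d : ℕ} {w : MvPolynomial σ R}
    (hw : w.IsHomogeneous d) {m : ℕ} (hm : m < d) (p : MvPolynomial σ R) :
    homogeneousComponent m (w * p) = 0 := by
  conv_lhs => rw [← sum_homogeneousComponent p, Finset.mul_sum, map_sum]
  refine Finset.sum_eq_zero fun i _ => ?_
  rw [homogeneousComponent_of_mem (hw.mul (homogeneousComponent_isHomogeneous i p)),
    if_neg (by omega)]

lemma dvd_homogeneousComponent {d : ℕ} {w : MvPolynomial σ R}
    (hw : w.IsHomogeneous d) {p : MvPolynomial σ R} (h : w ∣ p) (m : ℕ) :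
    w ∣ homogeneousComponent m p := by
  obtain ⟨r, rfl⟩ := h
  rcases lt_or_ge m d with hm | hm
  · rw [homogeneousComponent_mul_of_lt hw hm]
    exact dvd_zero _
  · obtain ⟨n, rfl⟩ := Nat.exists_eq_add_of_le hm
    rw [homogeneousComponent_add_mul_of_isHomogeneous hw]
    exact Dvd.intro _ rfl

lemma dvd_of_mem_span_pair_of_totalDegree_lt {d e : ℕ} {f w u : MvPolynomial σ R}
    (hf : f.IsHomogeneous e) (hw : w.IsHomogeneous d) (hu : u.totalDegree < d)
    (h : u ∈ Ideal.span {w, f}) : f ∣ u := by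
  obtain ⟨a, b, rfl⟩ := Ideal.mem_span_pair.1 h
  rw [← sum_homogeneousComponent (a * w + b * f)]
  refine Finset.dvd_sum fun m hm => ?_
  rw [Finset.mem_range] at hm
  rw [map_add, mul_comm a, homogeneousComponent_mul_of_lt hw (by omega), zero_add]
  exact dvd_homogeneousComponent hf (Dvd.intro_left _ rfl) m

lemma not_dvd_of_totalDegree_lt [IsDomain R] {f g : MvPolynomial σ R} (hg : g ≠ 0)
    (h : g.totalDegree < f.totalDegree) : ¬ f ∣ g := by
  rintro ⟨r, rfl⟩
  have hr : r ≠ 0 := by rintro rfl; simp at hg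
  have hf : f ≠ 0 := by rintro rfl; simp at hg
  rw [totalDegree_mul_of_isDomain hf hr] at h
  omega

end Graded

section Depth

variable {k : Type*} [Field k]

lemma mem_span_X_pow_iff {σ : Type*} (N : ℕ) (s : Set σ) (p : MvPolynomial σ k) :
    p ∈ Ideal.span ((fun i => (X i : MvPolynomial σ k) ^ N) '' s) ↔
      ∀ m ∈ p.support, ∃ i ∈ s, N ≤ m i := by
  have h : (fun i => (X i : MvPolynomial σ k) ^ N) '' s =
      (fun m => monomial m (1 : k)) '' ((fun i => Finsupp.single i N) '' s) := by
    rw [Set.image_image]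
    simp only [X_pow_eq_monomial]
  rw [h, mem_ideal_span_monomial_image]
  simp

lemma exists_eq_of_X_pow_mul_eq {σ : Type*} {i j : σ} (hij : i ≠ j) {N : ℕ}
    {a b : MvPolynomial σ k} (h : X i ^ N * a = X j ^ N * b) :
    ∃ c, a = X j ^ N * c ∧ b = X i ^ N * c := by
  have hX : IsRelPrime (X j : MvPolynomial σ k) (X i) := by
    rw [(X_prime (i := j)).irreducible.isRelPrime_iff_not_dvd]
    intro hd
    exact hij (X_dvd_X.1 hd).symm
  obtain ⟨c, rfl⟩ : X j ^ N ∣ a :=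
    (hX.pow (m := N) (n := N)).dvd_of_dvd_mul_left (h ▸ Dvd.intro _ rfl)
  refine ⟨c, rfl, ?_⟩
  have h0 : (X j : MvPolynomial σ k) ^ N ≠ 0 := pow_ne_zero _ (X_ne_zero _)
  apply mul_left_cancel₀ h0
  linear_combination -h

lemma mem_span_X_pow_pair_of_mul {N : ℕ} {γ : MvPolynomial (Fin 3) k}
    (h : X 2 ^ N * γ ∈ Ideal.span {X 0 ^ N, X 1 ^ N}) :
    γ ∈ Ideal.span {(X 0 : MvPolynomial (Fin 3) k) ^ N, X 1 ^ N} := by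
  have e : ({X 0 ^ N, X 1 ^ N} : Set (MvPolynomial (Fin 3) k)) =
      (fun i => (X i : MvPolynomial (Fin 3) k) ^ N) '' {0, 1} := by
    rw [Set.image_pair]
  rw [e, mem_span_X_pow_iff] at h ⊢
  intro m hm
  have := h (Finsupp.single 2 N + m) (by
    rw [mem_support_iff] at hm ⊢
    rwa [X_pow_eq_monomial, coeff_monomial_mul, one_mul])
  simpa using this

/-- A two-generated ideal `(w, f)` with `f` prime and `w ∉ (f)` in three variables has no
component supported at the origin. -/
lemma mem_span_pair_of_X_pow_mul_mem {f w u : MvPolynomial (Fin 3) k} (hf : Prime f)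
    (hw : ¬ f ∣ w) {N : ℕ} (h : ∀ i, X i ^ N * u ∈ Ideal.span {w, f}) :
    u ∈ Ideal.span {w, f} := by
  choose a b hab using fun i => Ideal.mem_span_pair.1 (h i)
  have key : ∀ i j, ∃ γ, X j ^ N * a i - X i ^ N * a j = f * γ ∧
      X j ^ N * b i - X i ^ N * b j = - (w * γ) := by
    intro i j
    have e : (X j ^ N * a i - X i ^ N * a j) * w = - f * (X j ^ N * b i - X i ^ N * b j) := by
      linear_combination X j ^ N * hab i - X i ^ N * hab j
    obtain ⟨γ, hγ⟩ : f ∣ X j ^ N * a i - X i ^ N * a j :=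
      (hf.dvd_or_dvd (e ▸ Dvd.intro (-(X j ^ N * b i - X i ^ N * b j)) (by ring))).resolve_right hw
    refine ⟨γ, hγ, mul_left_cancel₀ hf.ne_zero ?_⟩
    linear_combination e - w * hγ
  obtain ⟨γ, h1, h2⟩ := key 0 1
  obtain ⟨γ', h3, -⟩ := key 1 2
  obtain ⟨γ'', h5, -⟩ := key 2 0
  have hco : X 2 ^ N * γ + X 0 ^ N * γ' + X 1 ^ N * γ'' = 0 := by
    apply mul_left_cancel₀ hf.ne_zero
    linear_combination -X 2 ^ N * h1 - X 0 ^ N * h3 - X 1 ^ N * h5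
  obtain ⟨s, t, hst⟩ := Ideal.mem_span_pair.1 (mem_span_X_pow_pair_of_mul (N := N) (γ := γ)
    (Ideal.mem_span_pair.2 ⟨-γ', -γ'', by linear_combination -hco⟩))
  obtain ⟨c, -, hc⟩ := exists_eq_of_X_pow_mul_eq (i := (0 : Fin 3)) (j := 1) (by decide)
    (N := N) (a := a 1 + f * s) (b := a 0 - f * t) (by linear_combination -h1 + f * hst)
  obtain ⟨c', -, hc'⟩ := exists_eq_of_X_pow_mul_eq (i := (0 : Fin 3)) (j := 1) (by decide)
    (N := N) (a := b 1 - w * s) (b := b 0 + w * t) (by linear_combination -h2 - w * hst)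
  refine Ideal.mem_span_pair.2 ⟨c, c', ?_⟩
  apply mul_left_cancel₀ (pow_ne_zero N (X_ne_zero (R := k) (0 : Fin 3)))
  linear_combination hab 0 - w * hc - f * hc'

variable [IsAlgClosed k]

lemma exists_X_pow_mem_of_zeros {σ : Type*} [Finite σ] (J : Ideal (MvPolynomial σ k))
    (h : ∀ a : σ → k, (∀ g ∈ J, eval a g = 0) → a = 0) :
    ∃ N, ∀ i, X i ^ N ∈ J := by
  have : ∀ i, ∃ N, (X i : MvPolynomial σ k) ^ N ∈ J := by
    intro i
    rw [← Ideal.mem_radical_iff, ← vanishingIdeal_zeroLocus_eq_radical (K := k),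
      mem_vanishingIdeal_iff]
    intro a ha
    rw [h a fun g hg => by simpa [aeval_eq_eval] using ha g hg]
    simp
  choose N hN using this
  cases nonempty_fintype σ
  refine ⟨∑ i, N i, fun i => ?_⟩
  exact J.pow_mem_of_pow_mem (hN i) (Finset.single_le_sum (fun _ _ => Nat.zero_le _)
    (Finset.mem_univ i))

lemma exists_eval_ne_zero_of_not_dvd {σ : Type*} [Finite σ] {f g : MvPolynomial σ k}
    (hf : Prime f) (hg : ¬ f ∣ g) : ∃ a : σ → k, eval a f = 0 ∧ eval a g ≠ 0 := by
  by_contra! hcon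
  apply hg
  have : (Ideal.span {f}).IsPrime := (Ideal.span_singleton_prime hf.ne_zero).2 hf
  rw [← Ideal.mem_span_singleton, ← IsPrime.vanishingIdeal_zeroLocus (K := k) (Ideal.span {f}),
    mem_vanishingIdeal_iff]
  intro a ha
  have := ha f (Ideal.mem_span_singleton_self f)
  rw [aeval_eq_eval] at this ⊢
  exact hcon a this

/-- A compatible family of fractions `H t / θ t` on the cone `f = 0` which is regular away from
the origin and has negative degree vanishes. -/
lemma dvd_of_compatible_fractions {f : MvPolynomial (Fin 3) k} (hf : Prime f) {m : ℕ}
    (hfh : f.IsHomogeneous m) {ι : Type*} (θ H : ι → MvPolynomial (Fin 3) k) (s : ι) {d : ℕ}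
    (hθ : (θ s).IsHomogeneous d) (hH : (H s).totalDegree < d) (hs : ¬ f ∣ θ s)
    (hc : ∀ t, f ∣ θ t * H s - θ s * H t)
    (hz : ∀ a : Fin 3 → k, eval a f = 0 → (∀ t, eval a (θ t) = 0) → a = 0) (t : ι) :
    f ∣ H t := by
  have hHs : f ∣ H s := by
    obtain ⟨N, hN⟩ := exists_X_pow_mem_of_zeros (Ideal.span (insert f (Set.range θ))) (by
      intro a ha
      refine hz a (ha f (Ideal.subset_span (Set.mem_insert _ _))) fun t => ha _ ?_
      exact Ideal.subset_span (Set.mem_insert_of_mem _ ⟨t, rfl⟩))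
    refine dvd_of_mem_span_pair_of_totalDegree_lt hfh hθ hH
      (mem_span_pair_of_X_pow_mul_mem hf hs (N := N) fun i => ?_)
    refine Submodule.span_induction
      (p := fun g _ => g * H s ∈ Ideal.span {θ s, f}) ?_ ?_ ?_ ?_ (hN i)
    · rintro g (hg | ⟨t, rfl⟩)
      · exact Ideal.mem_span_pair.2 ⟨0, H s, by rw [hg]; ring⟩
      · obtain ⟨r, hr⟩ := hc t
        exact Ideal.mem_span_pair.2 ⟨H t, r, by linear_combination -hr⟩
    · simp
    · intro x y _ _ hx hy
      rw [add_mul]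
      exact add_mem hx hy
    · intro a x _ hx
      rw [smul_eq_mul, mul_assoc]
      exact Ideal.mul_mem_left _ _ hx
  have := (dvd_sub_right (hHs.mul_left (θ t))).1 (hc t)
  exact (hf.dvd_or_dvd this).resolve_left hs

end Depth

section Cubic

variable {R : Type*} [CommRing R]

lemma homogeneousComponent_mul_of_totalDegree_le {σ : Type*} {m n : ℕ} {g h : MvPolynomial σ R}
    (hg : g.totalDegree ≤ m) (hh : h.totalDegree ≤ n) :
    homogeneousComponent (m + n) (g * h) =
      homogeneousComponent m g * homogeneousComponent n h := by
  have hg' : ∑ i ∈ Finset.range (m + 1), homogeneousComponent i g = g := by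
    conv_rhs => rw [← sum_homogeneousComponent g]
    refine (Finset.sum_subset (fun i hi => ?_) fun i _ hi => ?_).symm
    · rw [Finset.mem_range] at hi ⊢
      omega
    · rw [Finset.mem_range] at hi
      exact homogeneousComponent_eq_zero _ _ (by omega)
  conv_lhs => rw [← hg', Finset.sum_mul, map_sum, Finset.sum_range_succ]
  rw [homogeneousComponent_add_mul_of_isHomogeneous (homogeneousComponent_isHomogeneous m g),
    add_eq_right]
  refine Finset.sum_eq_zero fun i hi => ?_
  rw [Finset.mem_range] at hi
  obtain ⟨r, hr⟩ : ∃ r, m + n = i + (n + 1 + r) := ⟨m - i - 1, by omega⟩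
  rw [hr, homogeneousComponent_add_mul_of_isHomogeneous (homogeneousComponent_isHomogeneous i g),
    homogeneousComponent_eq_zero _ h (by omega), mul_zero]

@[elab_as_elim]
lemma MvPolynomial.IsHomogeneous.induction_succ {σ : Type*} {n : ℕ}
    {motive : MvPolynomial σ R → Prop}
    (zero : motive 0) (add : ∀ p q, motive p → motive q → motive (p + q))
    (mul : ∀ i p, p.IsHomogeneous n → motive (X i * p))
    {f : MvPolynomial σ R} (hf : f.IsHomogeneous (n + 1)) : motive f := by
  classical
  rw [f.as_sum]
  refine Finset.sum_induction _ motive add zero fun d hd => ?_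
  have hdeg : d.degree = n + 1 := by
    by_contra h
    exact (mem_support_iff.1 hd) (hf.coeff_eq_zero h)
  obtain ⟨i, hi⟩ : ∃ i, d i ≠ 0 := by
    by_contra! h
    rw [show d = 0 from Finsupp.ext h] at hdeg
    simp at hdeg
  obtain ⟨d', rfl⟩ : ∃ d', d = Finsupp.single i 1 + d' := by
    refine ⟨d - Finsupp.single i 1, (add_tsub_cancel_of_le ?_).symm⟩
    rw [Finsupp.single_le_iff]
    omega
  rw [show (monomial (Finsupp.single i 1 + d')) (coeff (Finsupp.single i 1 + d') f) =
    X i * monomial d' (coeff (Finsupp.single i 1 + d') f) by rw [X, monomial_mul, one_mul]]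
  refine mul i _ (isHomogeneous_monomial _ ?_)
  rw [map_add, Finsupp.degree_single] at hdeg
  omega

variable {A : Type*} [CommRing A] [Algebra R A]

lemma aeval_mul_of_isHomogeneous {σ : Type*} {n : ℕ} {f : MvPolynomial σ R}
    (hf : f.IsHomogeneous n) (s : A) (P : σ → A) :
    aeval (fun l => s * P l) f = s ^ n * aeval P f := by
  induction n generalizing f with
  | zero =>
    rw [totalDegree_eq_zero_iff_eq_C.1 ((totalDegree_zero_iff_isHomogeneous _).2 hf)]
    simp
  | succ n ih =>
    refine IsHomogeneous.induction_succ ?_ ?_ ?_ hf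
    · simp
    · intro p q hp hq
      rw [map_add, map_add, hp, hq, mul_add]
    · intro i p hp
      rw [map_mul, map_mul, ih hp, aeval_X, aeval_X]
      ring

lemma aeval_add_of_isHomogeneous_one {f : MvPolynomial (Fin 3) R} (hf : f.IsHomogeneous 1)
    (P Q : Fin 3 → A) : aeval (fun l => P l + Q l) f = aeval P f + aeval Q f := by
  refine IsHomogeneous.induction_succ ?_ ?_ ?_ hf
  · simp
  · intro p q hp hq
    rw [map_add, map_add, map_add, hp, hq]
    ring
  · intro i p hp
    rw [totalDegree_eq_zero_iff_eq_C.1 ((totalDegree_zero_iff_isHomogeneous _).2 hp)]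
    simp
    ring

lemma sum_aeval_pderiv_X_mul (i : Fin 3) (p : MvPolynomial (Fin 3) R) (P Q : Fin 3 → A) :
    ∑ l, aeval P (pderiv l (X i * p)) * Q l =
      Q i * aeval P p + P i * ∑ l, aeval P (pderiv l p) * Q l := by
  simp only [pderiv_mul, pderiv_X, map_add, map_mul, aeval_X, add_mul, Finset.sum_add_distrib]
  congr 1
  · fin_cases i <;> simp [Pi.single_apply, mul_comm]
  · rw [Finset.mul_sum]
    simp only [mul_assoc]

lemma aeval_add_of_isHomogeneous_two {f : MvPolynomial (Fin 3) R} (hf : f.IsHomogeneous 2)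
    (P Q : Fin 3 → A) : aeval (fun l => P l + Q l) f =
      aeval P f + ∑ l, aeval P (pderiv l f) * Q l + aeval Q f ∧
      ∑ l, aeval P (pderiv l f) * Q l = ∑ l, aeval Q (pderiv l f) * P l := by
  refine IsHomogeneous.induction_succ ?_ ?_ ?_ hf
  · simp
  · rintro p q ⟨hp, hp'⟩ ⟨hq, hq'⟩
    simp only [map_add, add_mul, Finset.sum_add_distrib, hp, hq, hp', hq']
    exact ⟨by ring, trivial⟩
  · intro i p hp
    have h1 := aeval_add_of_isHomogeneous_one hp P Q
    have h2 : ∀ P Q : Fin 3 → A, ∑ l, aeval P (pderiv l p) * Q l = aeval Q p := by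
      intro P Q
      refine IsHomogeneous.induction_succ ?_ ?_ ?_ hp
      · simp
      · intro p q hp hq
        simp only [map_add, add_mul, Finset.sum_add_distrib, hp, hq]
      · intro i p hp
        rw [sum_aeval_pderiv_X_mul,
          totalDegree_eq_zero_iff_eq_C.1 ((totalDegree_zero_iff_isHomogeneous _).2 hp)]
        simp
    rw [sum_aeval_pderiv_X_mul, sum_aeval_pderiv_X_mul, map_mul, h1, h2, h2]
    simp only [map_mul, aeval_X]
    exact ⟨by ring, by ring⟩

lemma aeval_add_of_isHomogeneous_three {f : MvPolynomial (Fin 3) R} (hf : f.IsHomogeneous 3)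
    (P Q : Fin 3 → A) : aeval (fun l => P l + Q l) f =
      aeval P f + ∑ l, aeval P (pderiv l f) * Q l + ∑ l, aeval Q (pderiv l f) * P l
        + aeval Q f := by
  refine IsHomogeneous.induction_succ ?_ ?_ ?_ hf
  · simp
  · rintro p q hp hq
    simp only [map_add, add_mul, Finset.sum_add_distrib, hp, hq]
    ring
  · intro i p hp
    have h1 := aeval_add_of_isHomogeneous_two hp P Q
    have h3 : ∀ P : Fin 3 → A, ∑ l, aeval P (pderiv l p) * P l = 2 * aeval P p := by
      intro P
      have := congrArg (aeval P) hp.sum_X_mul_pderiv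
      simpa [Fin.sum_univ_three, mul_comm] using this
    rw [sum_aeval_pderiv_X_mul, sum_aeval_pderiv_X_mul, map_mul, h1.1, ← h1.2]
    simp only [map_mul, aeval_X]
    ring

end Cubic

section Prime

variable {k : Type*} [Field k]

lemma ne_zero_of_smooth {f : MvPolynomial (Fin 3) k}
    (hsmooth : ∀ a : Fin 3 → k, eval a f = 0 → (∀ i, eval a (pderiv i f) = 0) → a = 0) :
    f ≠ 0 := by
  rintro rfl
  exact one_ne_zero (congrFun (hsmooth (fun _ => 1) (by simp) (by simp)) 0)

variable [IsAlgClosed k]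

lemma exists_eval_eq_of_isHomogeneous_one {k : Type*} [CommRing k] {a : MvPolynomial (Fin 3) k}
    (ha : a.IsHomogeneous 1) :
    ∃ c : Fin 3 → k, ∀ P, eval P a = c 0 * P 0 + c 1 * P 1 + c 2 * P 2 := by
  refine IsHomogeneous.induction_succ ?_ ?_ ?_ ha
  · exact ⟨0, by simp⟩
  · rintro p q ⟨c, hc⟩ ⟨d, hd⟩
    refine ⟨c + d, fun P => ?_⟩
    rw [map_add, hc, hd]
    simp only [Pi.add_apply]
    ring
  · intro i p hp
    refine ⟨Pi.single i (coeff 0 p), fun P => ?_⟩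
    rw [totalDegree_eq_zero_iff_eq_C.1 ((totalDegree_zero_iff_isHomogeneous _).2 hp)]
    fin_cases i <;> simp [mul_comm]

lemma exists_common_zero_of_isHomogeneous_one_two {a b : MvPolynomial (Fin 3) k}
    (ha : a.IsHomogeneous 1) (hb : b.IsHomogeneous 2) :
    ∃ P : Fin 3 → k, P ≠ 0 ∧ eval P a = 0 ∧ eval P b = 0 := by
  obtain ⟨c, hc⟩ := exists_eval_eq_of_isHomogeneous_one ha
  obtain ⟨u, v, hu, huv, hau⟩ : ∃ u v : Fin 3 → k, u ≠ 0 ∧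
      (∀ t : k, (fun l => t * u l + v l) ≠ 0) ∧ ∀ t : k, eval (fun l => t * u l + v l) a = 0 ∧
        eval u a = 0 := by
    simp only [hc]
    by_cases h0 : c 0 = 0
    · by_cases h1 : c 1 = 0
      · refine ⟨![1, 0, 0], ![0, 1, 0], fun h => by simpa using congrFun h 0,
          fun t h => by simpa using congrFun h 1, fun t => ?_⟩
        simp [h0, h1]
      · refine ⟨![1, 0, 0], ![0, -c 2, c 1], fun h => by simpa using congrFun h 0,
          fun t h => h1 (by simpa using congrFun h 2), fun t => ?_⟩
        simp [h0]
        ring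
    · refine ⟨![-c 1, c 0, 0], ![-c 2, 0, c 0], fun h => h0 (by simpa using congrFun h 1),
          fun t h => h0 (by simpa using congrFun h 2), fun t => ?_⟩
      simp
      constructor <;> ring
  by_cases hbu : eval u b = 0
  · exact ⟨u, hu, (hau 0).2, hbu⟩
  set m := ∑ l, eval v (pderiv l b) * u l with hm
  have hpol : ∀ t : k, eval (fun l => t * u l + v l) b = eval u b * t ^ 2 + m * t + eval v b := by
    intro t
    have h := aeval_add_of_isHomogeneous_two hb (fun l => t * u l) v
    have h' := aeval_mul_of_isHomogeneous hb t u
    rw [h.2, h'] at h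
    simp only [aeval_eq_eval] at h
    rw [h.1, hm, Finset.sum_mul]
    simp only [mul_assoc, mul_comm t]
    ring
  obtain ⟨t, ht⟩ := IsAlgClosed.exists_root (Polynomial.C (eval u b) * Polynomial.X ^ 2 +
    Polynomial.C m * Polynomial.X + Polynomial.C (eval v b)) (by
      rw [Polynomial.degree_quadratic hbu]; decide)
  refine ⟨_, huv t, (hau t).1, ?_⟩
  rw [hpol]
  simpa only [Polynomial.IsRoot, Polynomial.eval_add, Polynomial.eval_mul, Polynomial.eval_C,
    Polynomial.eval_pow, Polynomial.eval_X] using ht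

variable {f : MvPolynomial (Fin 3) k}

lemma not_eq_mul_of_smooth (hf : f.IsHomogeneous 3)
    (hsmooth : ∀ a : Fin 3 → k, eval a f = 0 → (∀ i, eval a (pderiv i f) = 0) → a = 0)
    {g h : MvPolynomial (Fin 3) k} (hg : g.totalDegree ≤ 1) (hh : h.totalDegree ≤ 2) :
    f ≠ g * h := by
  intro hfgh
  have e : f = homogeneousComponent 1 g * homogeneousComponent 2 h := by
    rw [← homogeneousComponent_mul_of_totalDegree_le hg hh, ← hfgh, homogeneousComponent_eq_self hf]
  obtain ⟨P, hP, h1, h2⟩ := exists_common_zero_of_isHomogeneous_one_two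
    (homogeneousComponent_isHomogeneous 1 g) (homogeneousComponent_isHomogeneous 2 h)
  refine hP (hsmooth P ?_ fun i => ?_)
  · rw [e, map_mul, h1, zero_mul]
  · rw [e, pderiv_mul, map_add, map_mul, map_mul, h1, h2, mul_zero, zero_mul, add_zero]

lemma prime_of_smooth (hf : f.IsHomogeneous 3)
    (hsmooth : ∀ a : Fin 3 → k, eval a f = 0 → (∀ i, eval a (pderiv i f) = 0) → a = 0) :
    Prime f := by
  have hf0 := ne_zero_of_smooth hsmooth
  have hdeg := hf.totalDegree hf0
  refine Irreducible.prime ⟨fun hu => ?_, fun {g h} hfgh => ?_⟩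
  · have := hu.map (eval (0 : Fin 3 → k))
    rw [eval_zero, constantCoeff_eq, hf.coeff_eq_zero (by simp)] at this
    exact not_isUnit_zero this
  · have hg0 : g ≠ 0 := by rintro rfl; simp [hfgh] at hf0
    have hh0 : h ≠ 0 := by rintro rfl; simp [hfgh] at hf0
    rw [hfgh, totalDegree_mul_of_isDomain hg0 hh0] at hdeg
    have unit : ∀ g : MvPolynomial (Fin 3) k, g ≠ 0 → g.totalDegree = 0 → IsUnit g := by
      intro g hg0 hg
      rw [totalDegree_eq_zero_iff_eq_C.1 hg] at hg0 ⊢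
      exact (isUnit_iff_ne_zero.2 fun h => hg0 (by rw [h, C_0])).map C
    rcases Nat.eq_zero_or_pos g.totalDegree with h1 | h1
    · exact Or.inl (unit g hg0 h1)
    rcases Nat.eq_zero_or_pos h.totalDegree with h2 | h2
    · exact Or.inr (unit h hh0 h2)
    rcases Nat.lt_or_ge g.totalDegree 2 with h3 | h3
    · exact absurd hfgh (not_eq_mul_of_smooth hf hsmooth (by omega) (by omega))
    · exact absurd (hfgh.trans (mul_comm _ _))
        (not_eq_mul_of_smooth hf hsmooth (by omega) (by omega))

end Prime

section Chart

variable {k : Type*} [CommRing k]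

/-- The coefficient of `T ^ m` has degree at most `a + 3 * m` for every `m`. -/
def CoeffDegreeLE (a : ℕ) (F : Polynomial (MvPolynomial (Fin 3) k)) : Prop :=
  ∀ m, (F.coeff m).totalDegree ≤ a + 3 * m

namespace CoeffDegreeLE

variable {a b : ℕ} {F G : Polynomial (MvPolynomial (Fin 3) k)}

lemma zero (a : ℕ) : CoeffDegreeLE a (0 : Polynomial (MvPolynomial (Fin 3) k)) := by
  intro m
  simp

lemma C {s : MvPolynomial (Fin 3) k} (hs : s.totalDegree ≤ a) :
    CoeffDegreeLE a (Polynomial.C s) := by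
  intro m
  rw [Polynomial.coeff_C]
  split_ifs
  · omega
  · simp

lemma add (hF : CoeffDegreeLE a F) (hG : CoeffDegreeLE a G) : CoeffDegreeLE a (F + G) := by
  intro m
  rw [Polynomial.coeff_add]
  exact (totalDegree_add _ _).trans (max_le (hF m) (hG m))

lemma sum {ι : Type*} (s : Finset ι) {F : ι → Polynomial (MvPolynomial (Fin 3) k)}
    (h : ∀ l ∈ s, CoeffDegreeLE a (F l)) : CoeffDegreeLE a (∑ l ∈ s, F l) :=
  Finset.sum_induction _ _ (fun _ _ => add) (zero a) h

lemma mul (hF : CoeffDegreeLE a F) (hG : CoeffDegreeLE b G) : CoeffDegreeLE (a + b) (F * G) := by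
  intro m
  rw [Polynomial.coeff_mul]
  refine totalDegree_finsetSum_le fun x hx => (totalDegree_mul _ _).trans ?_
  rw [Finset.HasAntidiagonal.mem_antidiagonal] at hx
  have h1 := hF x.1
  have h2 := hG x.2
  omega

lemma neg (hF : CoeffDegreeLE a F) : CoeffDegreeLE a (-F) := by
  intro m
  rw [Polynomial.coeff_neg, totalDegree_neg]
  exact hF m

lemma X_mul (hF : CoeffDegreeLE (a + 3) F) : CoeffDegreeLE a (Polynomial.X * F) := by
  intro m
  cases m with
  | zero => simp
  | succ m =>
    rw [Polynomial.coeff_X_mul]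
    have := hF m
    omega

lemma aeval_of_isHomogeneous {P : Fin 3 → Polynomial (MvPolynomial (Fin 3) k)}
    (hP : ∀ l, CoeffDegreeLE a (P l)) {n : ℕ} {g : MvPolynomial (Fin 3) k}
    (hg : g.IsHomogeneous n) : CoeffDegreeLE (n * a) (aeval P g) := by
  induction n generalizing g with
  | zero =>
    rw [totalDegree_eq_zero_iff_eq_C.1 ((totalDegree_zero_iff_isHomogeneous _).2 hg), aeval_C,
      IsScalarTower.algebraMap_apply k (MvPolynomial (Fin 3) k), Polynomial.algebraMap_eq]
    refine C ?_
    rw [algebraMap_eq, totalDegree_C]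
    omega
  | succ n ih =>
    refine IsHomogeneous.induction_succ ?_ ?_ ?_ hg
    · rw [map_zero]
      exact zero _
    · intro p q hp hq
      rw [map_add]
      exact add hp hq
    · intro i p hp
      rw [map_mul, aeval_X, add_mul, one_mul, add_comm]
      exact mul (hP i) (ih hp)

end CoeffDegreeLE

lemma dvd_aeval_sub_aeval {σ R A : Type*} [CommRing R] [CommRing A] [Algebra R A] {d : A}
    {P Q : σ → A} (h : ∀ l, d ∣ P l - Q l) (g : MvPolynomial σ R) :
    d ∣ aeval P g - aeval Q g := by
  induction g using MvPolynomial.induction_on with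
  | C a => simp
  | add p q hp hq =>
    rw [map_add, map_add, add_sub_add_comm]
    exact dvd_add hp hq
  | mul_X p i hp =>
    rw [map_mul, map_mul, aeval_X, aeval_X, show aeval P p * P i - aeval Q p * Q i =
      (aeval P p - aeval Q p) * P i + aeval Q p * (P i - Q i) by ring]
    exact dvd_add (hp.mul_right _) ((h i).mul_left _)

/-- The `l`-th coordinate of `e_i × ∇f`. -/
noncomputable def tangentField (f : MvPolynomial (Fin 3) k) (i : Fin 3) :
    Fin 3 → MvPolynomial (Fin 3) k :=
  crossProduct (Pi.single i 1) (fun l => pderiv l f)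

/-- A formal parametrization of the cone `f = 0`, up to order `M` in the parameter, starting at
the generic point with velocity `f_j • (e_i × ∇f)`. -/
structure IsChart (f : MvPolynomial (Fin 3) k) (i j : Fin 3) (M : ℕ)
    (Φ : MvPolynomial (Fin 3) k →ₐ[k] Polynomial (MvPolynomial (Fin 3) k)) : Prop where
  coeff_zero : ∀ a, (Φ a).coeff 0 = a
  dvd_sub : Polynomial.X ^ M ∣ Φ f - Polynomial.C f
  coeff_one : ∀ l, (Φ (X l)).coeff 1 = pderiv j f * tangentField f i l
  totalDegree_le : ∀ e (a : MvPolynomial (Fin 3) k), a.IsHomogeneous e →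
    ∀ m, ((Φ a).coeff m).totalDegree ≤ e + 3 * m

lemma exists_isChart {f : MvPolynomial (Fin 3) k} (hf : f.IsHomogeneous 3) (i j : Fin 3) (M : ℕ) :
    ∃ Φ, IsChart f i j M Φ := by
  let T : Polynomial (MvPolynomial (Fin 3) k) := Polynomial.X
  let W : Polynomial (MvPolynomial (Fin 3) k) → Fin 3 → Polynomial (MvPolynomial (Fin 3) k) :=
    fun ζ l => Polynomial.C (tangentField f i l) + ζ * (if l = j then 1 else 0)
  let g : Polynomial (MvPolynomial (Fin 3) k) → Polynomial (MvPolynomial (Fin 3) k) :=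
    fun ζ => T * ∑ l, aeval (W ζ) (pderiv l f) * Polynomial.C (X l) +
      T * (T * (Polynomial.C (pderiv j f) * aeval (W ζ) f))
  have hu : ∀ l, (tangentField f i l).totalDegree ≤ 2 := by
    intro l
    have hl : ∀ l, (pderiv l f).totalDegree ≤ 2 := fun l => hf.pderiv.totalDegree_le
    have h1 := hl 0
    have h2 := hl 1
    have h3 := hl 2
    fin_cases i <;> fin_cases l <;> simp [tangentField, cross_apply, *]
  have hW : ∀ ζ, CoeffDegreeLE 2 ζ → ∀ l, CoeffDegreeLE 2 (W ζ l) := by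
    intro ζ hζ l
    refine (CoeffDegreeLE.C (hu l)).add (CoeffDegreeLE.mul (b := 0) hζ ?_)
    split_ifs
    · exact CoeffDegreeLE.C (s := 1) (by simp)
    · exact CoeffDegreeLE.zero _
  have hsolve : ∀ M, ∃ ζ, CoeffDegreeLE 2 ζ ∧ T ∣ ζ ∧ T ^ M ∣ ζ + g ζ := by
    have hg : ∀ ζ, CoeffDegreeLE 2 ζ → CoeffDegreeLE 2 (g ζ) := by
      intro ζ hζ
      refine CoeffDegreeLE.add (CoeffDegreeLE.X_mul (CoeffDegreeLE.sum _ fun l _ => ?_))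
        (CoeffDegreeLE.X_mul (CoeffDegreeLE.X_mul ?_))
      · exact CoeffDegreeLE.mul (a := 4) (b := 1)
          (CoeffDegreeLE.aeval_of_isHomogeneous (hW ζ hζ) (n := 2) hf.pderiv)
          (CoeffDegreeLE.C (isHomogeneous_X _ _).totalDegree_le)
      · exact CoeffDegreeLE.mul (a := 2) (b := 6) (CoeffDegreeLE.C hf.pderiv.totalDegree_le)
          (CoeffDegreeLE.aeval_of_isHomogeneous (hW ζ hζ) hf)
    have hgT : ∀ ζ, T ∣ g ζ := fun ζ => dvd_add (Dvd.intro _ rfl) (Dvd.intro _ rfl)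
    intro M
    induction M with
    | zero => exact ⟨0, CoeffDegreeLE.zero _, dvd_zero _, by simp⟩
    | succ M ih =>
      obtain ⟨ζ, h1, h2, h3⟩ := ih
      refine ⟨-g ζ, (hg ζ h1).neg, (hgT ζ).neg_right, ?_⟩
      have hd : ∀ l, T ^ M ∣ W (-g ζ) l - W ζ l := by
        intro l
        simp only [W]
        rw [add_sub_add_left_eq_sub, ← sub_mul, show -g ζ - ζ = - (ζ + g ζ) by ring]
        exact h3.neg_right.mul_right _
      have e : -g ζ + g (-g ζ) =
          T * (∑ l, (aeval (W (-g ζ)) (pderiv l f) - aeval (W ζ) (pderiv l f)) *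
            Polynomial.C (X l) + T * (Polynomial.C (pderiv j f) *
            (aeval (W (-g ζ)) f - aeval (W ζ) f))) := by
        simp only [g, sub_mul, Finset.sum_sub_distrib]
        ring
      rw [e, pow_succ']
      refine mul_dvd_mul_left _ (dvd_add (Finset.dvd_sum fun l _ => ?_) ?_)
      · exact (dvd_aeval_sub_aeval hd _).mul_right _
      · exact ((dvd_aeval_sub_aeval hd _).mul_left _).mul_left _
  obtain ⟨ζ, h1, ⟨ξ, h2⟩, h3⟩ := hsolve M
  have h20 : ζ.coeff 0 = 0 := by rw [h2, Polynomial.coeff_X_mul_zero]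
  let P : Fin 3 → Polynomial (MvPolynomial (Fin 3) k) :=
    fun l => Polynomial.C (X l) + Polynomial.C (pderiv j f) * T * W ζ l
  have hP0 : ∀ l, (P l).coeff 0 = X l := by
    intro l
    simp [P, T, Polynomial.mul_coeff_zero]
  refine ⟨aeval P, ?_, ?_, ?_, ?_⟩
  · intro a
    induction a using MvPolynomial.induction_on with
    | C a =>
      rw [aeval_C, IsScalarTower.algebraMap_apply k (MvPolynomial (Fin 3) k),
        Polynomial.algebraMap_eq, Polynomial.coeff_C_zero, algebraMap_eq]
    | add p q hp hq => rw [map_add, Polynomial.coeff_add, hp, hq]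
    | mul_X p i hp => rw [map_mul, Polynomial.mul_coeff_zero, hp, aeval_X, hP0]
  · have hC : ∀ g : MvPolynomial (Fin 3) k,
        aeval (fun l => (Polynomial.C (X l) : Polynomial (MvPolynomial (Fin 3) k))) g =
          Polynomial.C g := by
      intro g
      induction g using MvPolynomial.induction_on with
      | C a =>
        rw [aeval_C, IsScalarTower.algebraMap_apply k (MvPolynomial (Fin 3) k),
          Polynomial.algebraMap_eq, algebraMap_eq]
      | add p q hp hq => rw [map_add, map_add, hp, hq]
      | mul_X p i hp => rw [map_mul, map_mul, aeval_X, hp]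
    have hlin : ∑ l, Polynomial.C (pderiv l f) * W ζ l = ζ * Polynomial.C (pderiv j f) := by
      simp only [W, mul_add, Finset.sum_add_distrib, mul_ite, mul_one, mul_zero,
        Finset.sum_ite_eq', Finset.mem_univ, if_true]
      have : ∑ l, pderiv l f * tangentField f i l = 0 :=
        dot_cross_self (Pi.single i 1) fun l => pderiv l f
      simp only [← Polynomial.C_mul]
      rw [← map_sum, this, map_zero, zero_add, mul_comm]
    have h2 : ∀ l, aeval (fun l => Polynomial.C (pderiv j f) * T * W ζ l) (pderiv l f) =
        (Polynomial.C (pderiv j f) * T) ^ 2 * aeval (W ζ) (pderiv l f) :=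
      fun l => aeval_mul_of_isHomogeneous hf.pderiv _ _
    have e : aeval P f - Polynomial.C f =
        (ζ + g ζ) * (Polynomial.C (pderiv j f) ^ 2 * T) := by
      simp only [P, g]
      rw [aeval_add_of_isHomogeneous_three hf, hC, aeval_mul_of_isHomogeneous hf]
      simp only [hC, h2]
      have h3 : ∑ l, Polynomial.C (pderiv l f) * (Polynomial.C (pderiv j f) * T * W ζ l) =
          Polynomial.C (pderiv j f) * T * (ζ * Polynomial.C (pderiv j f)) := by
        rw [← hlin, Finset.mul_sum]
        exact Finset.sum_congr rfl fun l _ => by ring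
      rw [h3]
      simp only [mul_assoc, ← Finset.mul_sum]
      ring
    rw [e]
    exact h3.mul_right _
  · intro l
    rw [aeval_X]
    simp only [P, T, W]
    rw [Polynomial.coeff_add, Polynomial.coeff_C_of_ne_zero one_ne_zero, zero_add, mul_assoc,
      Polynomial.coeff_C_mul, Polynomial.coeff_X_mul, Polynomial.coeff_add,
      Polynomial.coeff_C_zero, Polynomial.mul_coeff_zero, h20, zero_mul, add_zero]
  · intro e a ha m
    have hP : ∀ l, CoeffDegreeLE 1 (P l) := by
      intro l
      refine (CoeffDegreeLE.C (isHomogeneous_X _ _).totalDegree_le).add ?_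
      rw [mul_comm (Polynomial.C _), mul_assoc]
      exact CoeffDegreeLE.X_mul (CoeffDegreeLE.mul (a := 2) (b := 2)
        (CoeffDegreeLE.C hf.pderiv.totalDegree_le) (hW ζ h1 l))
    simpa using CoeffDegreeLE.aeval_of_isHomogeneous hP ha m

end Chart

section LocalDivision

variable {R : Type*} [CommRing R]

lemma exists_third_index {i j : Fin 3} (hij : i ≠ j) :
    ∃ k, k ≠ i ∧ k ≠ j ∧ (Finset.univ : Finset (Fin 3)) = {i, j, k} := by
  revert i j
  decide

/-- Modulo the linear forms vanishing at the projective point `P`, a homogeneous polynomial is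
determined by its value at `P`. -/
lemma exists_pow_mul_eq_sum_linear (P : Fin 3 → R) (i : Fin 3) {e : ℕ}
    {G : MvPolynomial (Fin 3) R} (hG : G.IsHomogeneous e) :
    ∃ A : Fin 3 → MvPolynomial (Fin 3) R, C (P i) ^ e * G =
      ∑ l, (C (P i) * X l - C (P l) * X i) * A l + C (eval P G) * X i ^ e := by
  induction e generalizing G with
  | zero =>
    refine ⟨0, ?_⟩
    rw [totalDegree_eq_zero_iff_eq_C.1 ((totalDegree_zero_iff_isHomogeneous _).2 hG)]
    simp
  | succ e ih =>
    refine IsHomogeneous.induction_succ ?_ ?_ ?_ hG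
    · exact ⟨0, by simp⟩
    · rintro p q ⟨A, hA⟩ ⟨B, hB⟩
      refine ⟨A + B, ?_⟩
      simp only [Pi.add_apply, mul_add, Finset.sum_add_distrib, hA, hB, map_add, add_mul]
      ring
    · intro l p hp
      obtain ⟨A, hA⟩ := ih hp
      refine ⟨fun t => C (P i) * X l * A t + (if t = l then C (eval P p) * X i ^ e else 0), ?_⟩
      have h1 : ∑ t, (C (P i) * X t - C (P t) * X i) *
          (C (P i) * X l * A t + (if t = l then C (eval P p) * X i ^ e else 0)) =
          C (P i) * X l * ∑ t, (C (P i) * X t - C (P t) * X i) * A t +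
            (C (P i) * X l - C (P l) * X i) * (C (eval P p) * X i ^ e) := by
        simp only [mul_add, Finset.sum_add_distrib, mul_ite, mul_zero,
          Finset.sum_ite_eq', Finset.mem_univ, if_true, Finset.mul_sum]
        congr 1
        exact Finset.sum_congr rfl fun t _ => by ring
      rw [h1, map_mul, eval_X, map_mul]
      linear_combination C (P i) * X l * hA

lemma isHomogeneous_linear (P : Fin 3 → R) (i l : Fin 3) :
    (C (P i) * X l - C (P l) * X i : MvPolynomial (Fin 3) R).IsHomogeneous 1 :=
  ((isHomogeneous_X R l).C_mul _).sub ((isHomogeneous_X R i).C_mul _)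

lemma exists_pow_mul_eq_of_eval_eq_zero {P : Fin 3 → R} {i j k : Fin 3} (hki : k ≠ i) (hkj : k ≠ j)
    (hij : i ≠ j) (huniv : (Finset.univ : Finset (Fin 3)) = {i, j, k}) {e : ℕ}
    {G : MvPolynomial (Fin 3) R} (hG : G.IsHomogeneous (e + 1)) (h : eval P G = 0) :
    ∃ A B : MvPolynomial (Fin 3) R, A.IsHomogeneous e ∧ B.IsHomogeneous e ∧
      C (P i) ^ (e + 1) * G =
        (C (P i) * X j - C (P j) * X i) * A + (C (P i) * X k - C (P k) * X i) * B := by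
  obtain ⟨A, hA⟩ := exists_pow_mul_eq_sum_linear P i hG
  rw [huniv, Finset.sum_insert (by simp [hij, hki.symm]), Finset.sum_insert (by simp [hkj.symm]),
    Finset.sum_singleton, h, C_0] at hA
  refine ⟨homogeneousComponent e (A j), homogeneousComponent e (A k),
    homogeneousComponent_isHomogeneous _ _, homogeneousComponent_isHomogeneous _ _, ?_⟩
  rw [← homogeneousComponent_add_mul_of_isHomogeneous (isHomogeneous_linear P i j),
    ← homogeneousComponent_add_mul_of_isHomogeneous (isHomogeneous_linear P i k), ← map_add,
    add_comm 1 e]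
  have hG' : (C (P i) ^ (e + 1) * G).IsHomogeneous (e + 1) := by
    rw [← C_pow]
    exact hG.C_mul _
  rw [← homogeneousComponent_eq_self hG', hA]
  congr 1
  ring

variable [IsDomain R] {F : MvPolynomial (Fin 3) R} {P : Fin 3 → R} {i j : Fin 3}

lemma exists_mul_sub_linear_mul_dvd (hF : F.IsHomogeneous 3) (hFP : eval P F = 0) (hij : i ≠ j)
    (hPi : P i ≠ 0) (hFj : eval P (pderiv j F) ≠ 0) :
    ∃ L : MvPolynomial (Fin 3) R, eval P L = 0 ∧ ∀ e (G : MvPolynomial (Fin 3) R),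
      G.IsHomogeneous e → eval P G = 0 → ∃ s H : MvPolynomial (Fin 3) R,
        (∃ d, s.IsHomogeneous d) ∧ (∃ d, H.IsHomogeneous d) ∧ eval P s ≠ 0 ∧
          F ∣ s * G - L * H := by
  obtain ⟨k, hki, hkj, huniv⟩ := exists_third_index hij
  refine ⟨C (P i) * X k - C (P k) * X i, by simp [mul_comm], ?_⟩
  intro e G hG hGP
  cases e with
  | zero =>
    rw [totalDegree_eq_zero_iff_eq_C.1 ((totalDegree_zero_iff_isHomogeneous _).2 hG),
      eval_C] at hGP
    rw [totalDegree_eq_zero_iff_eq_C.1 ((totalDegree_zero_iff_isHomogeneous _).2 hG), hGP]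
    exact ⟨1, 0, ⟨0, isHomogeneous_one _ _⟩, ⟨0, isHomogeneous_zero _ _ _⟩, by simp, by simp⟩
  | succ e =>
    obtain ⟨A, B, hA, hB, hAB⟩ := exists_pow_mul_eq_of_eval_eq_zero hki hkj hij huniv hG hGP
    obtain ⟨a, b, ha, hb, hab⟩ := exists_pow_mul_eq_of_eval_eq_zero hki hkj hij huniv hF hFP
    refine ⟨a * C (P i ^ (e + 1)), a * B - A * b, ⟨_, ha.mul (isHomogeneous_C _ _)⟩,
      ⟨2 + e, (ha.mul hB).sub (by rw [add_comm]; exact hA.mul hb)⟩, ?_, ?_⟩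
    · have hd := congrArg (fun g => eval P (pderiv j g)) hab
      simp only [pderiv_mul, map_add, map_mul, ← C_pow, pderiv_C, map_sub, eval_X, eval_C,
        map_zero, map_one, pderiv_X_self, pderiv_X_of_ne hij, pderiv_X_of_ne hkj] at hd
      rw [map_mul, eval_C]
      refine mul_ne_zero (fun h0 => ?_) (pow_ne_zero _ hPi)
      rw [h0] at hd
      refine mul_ne_zero (pow_ne_zero (2 + 1) hPi) hFj ?_
      linear_combination hd
    · refine ⟨A * C (P i) ^ 3, ?_⟩
      rw [C_pow]
      linear_combination a * hAB - A * hab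

variable {M : ℕ} {ψ : MvPolynomial (Fin 3) R →ₐ[R] Polynomial R}

/-- On the cubic `F`, up to multipliers not vanishing at the smooth point `P`, a homogeneous
polynomial vanishing to order `m` along a branch at `P` is divisible by the `m`-th power of
any local parameter. -/
lemma exists_dvd_mul_sub_mul_pow (hF : F.IsHomogeneous 3) (hFP : eval P F = 0) (hij : i ≠ j)
    (hPi : P i ≠ 0) (hFj : eval P (pderiv j F) ≠ 0) (hψ : ∀ a, (ψ a).coeff 0 = eval P a)
    (hM : 2 ≤ M) (hψF : Polynomial.X ^ M ∣ ψ F) {d : ℕ} {N : MvPolynomial (Fin 3) R}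
    (hN : N.IsHomogeneous d) (hNP : eval P N = 0) (hN1 : (ψ N).coeff 1 ≠ 0) {m : ℕ} (hm : m ≤ M)
    {e : ℕ} {G : MvPolynomial (Fin 3) R} (hG : G.IsHomogeneous e)
    (hGm : Polynomial.X ^ m ∣ ψ G) :
    ∃ s H : MvPolynomial (Fin 3) R, (∃ d, s.IsHomogeneous d) ∧ eval P s ≠ 0 ∧
      F ∣ s * G - H * N ^ m := by
  obtain ⟨L, hL, hdiv⟩ := exists_mul_sub_linear_mul_dvd hF hFP hij hPi hFj
  obtain ⟨s, N', ⟨ds, hs⟩, ⟨dN, hN'⟩, hsP, hsN⟩ := hdiv d N hN hNP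
  have hX : ∀ a, eval P a = 0 → ∃ b, ψ a = Polynomial.X * b ∧ (ψ a).coeff 1 = b.coeff 0 := by
    intro a ha
    obtain ⟨b, hb⟩ := Polynomial.X_dvd_iff.2 ((hψ a).trans ha)
    exact ⟨b, hb, by rw [hb, Polynomial.coeff_X_mul]⟩
  obtain ⟨n, hn, hn1⟩ := hX N hNP
  have hN'P : eval P N' ≠ 0 := by
    intro h0
    obtain ⟨b, hb, -⟩ := hX L hL
    obtain ⟨c, hc, -⟩ := hX N' h0
    have h2 : Polynomial.X ^ 2 ∣ ψ s * ψ N - ψ L * ψ N' := by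
      rw [← map_mul, ← map_mul, ← map_sub]
      exact (pow_dvd_pow _ hM).trans (hψF.trans (map_dvd ψ hsN))
    have h3 : Polynomial.X ^ 2 ∣ ψ s * ψ N := by
      refine (dvd_sub_left (Dvd.intro (b * c) ?_)).1 h2
      rw [hb, hc]
      ring
    have h4 := Polynomial.X_pow_dvd_iff.1 h3 1 one_lt_two
    rw [hn, mul_left_comm, Polynomial.coeff_X_mul, Polynomial.mul_coeff_zero, hψ, ← hn1] at h4
    exact mul_ne_zero hsP hN1 h4
  induction m generalizing e G with
  | zero => exact ⟨1, G, ⟨0, isHomogeneous_one _ _⟩, by simp, by simp⟩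
  | succ m ih =>
    have hGP : eval P G = 0 := by
      rw [← hψ]
      exact Polynomial.X_pow_dvd_iff.1 hGm 0 (Nat.succ_pos m)
    obtain ⟨t, H, ⟨dt, ht⟩, ⟨dH, hH⟩, htP, htH⟩ := hdiv e G hG hGP
    have h1 : F ∣ t * N' * G - N * (H * s) := by
      convert dvd_sub (htH.mul_left N') (hsN.mul_left H) using 1
      ring
    have h2 : Polynomial.X ^ m ∣ ψ (H * s) := by
      have h3 : Polynomial.X ^ (m + 1) ∣ ψ N * ψ (H * s) := by
        have := (pow_dvd_pow _ hm).trans (hψF.trans (map_dvd ψ h1))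
        rw [map_sub, map_mul, map_mul ψ N] at this
        exact (dvd_sub_right (hGm.mul_left _)).1 this
      rw [hn, mul_assoc, pow_succ'] at h3
      refine Polynomial.prime_X.pow_dvd_of_dvd_mul_left m ?_
        ((mul_dvd_mul_iff_left Polynomial.X_ne_zero).1 h3)
      rw [Polynomial.X_dvd_iff, ← hn1]
      exact hN1
    obtain ⟨u, K, ⟨du, hu⟩, huP, huK⟩ := ih (by omega) (hH.mul hs) h2
    refine ⟨u * (t * N'), K, ⟨_, hu.mul (ht.mul hN')⟩, ?_, ?_⟩
    · rw [map_mul, map_mul]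
      exact mul_ne_zero huP (mul_ne_zero htP hN'P)
    · convert dvd_add (h1.mul_left u) (huK.mul_left N) using 1
      ring

end LocalDivision

section Cross

variable {R : Type*} [CommRing R]

lemma mul_cross_eq_mul_cross {x v w : Fin 3 → R} (hv : ∑ l, v l * x l = 0)
    (hw : ∑ l, w l * x l = 0) (a b : Fin 3) :
    x a * crossProduct v w b = x b * crossProduct v w a := by
  rw [Fin.sum_univ_three] at hv hw
  fin_cases a <;> fin_cases b <;> simp [cross_apply]
  · linear_combination v 2 * hw - w 2 * hv
  · linear_combination w 1 * hv - v 1 * hw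
  · linear_combination w 2 * hv - v 2 * hw
  · linear_combination v 0 * hw - w 0 * hv
  · linear_combination v 1 * hw - w 1 * hv
  · linear_combination w 0 * hv - v 0 * hw

end Cross

section Branch

variable {k R : Type*} [CommRing k] [CommRing R] [Algebra k R]
  (π : MvPolynomial (Fin 3) k →ₐ[k] R)
  (Φ : MvPolynomial (Fin 3) k →ₐ[k] Polynomial (MvPolynomial (Fin 3) k))

/-- The branch at the `R`-valued point `π` obtained by specializing `Φ`. -/
noncomputable def branch : MvPolynomial (Fin 3) R →ₐ[R] Polynomial R :=
  aeval fun l => (Φ (X l)).map π.toRingHom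

lemma branch_map (a : MvPolynomial (Fin 3) k) :
    branch π Φ (map (algebraMap k R) a) = (Φ a).map π.toRingHom := by
  induction a using MvPolynomial.induction_on with
  | C a =>
    have h1 : branch π Φ (C (algebraMap k R a)) = Polynomial.C (algebraMap k R a) :=
      (branch π Φ).commutes _
    have h2 : Φ (C a) = Polynomial.C (C a) := Φ.commutes a
    rw [map_C, h1, h2, Polynomial.map_C]
    exact congrArg _ (π.commutes a).symm
  | add p q hp hq => rw [map_add, map_add, hp, hq, map_add, Polynomial.map_add]
  | mul_X p i hp =>
    rw [map_mul, map_mul, hp, map_X, branch, aeval_X, map_mul, Polynomial.map_mul]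

lemma eval_map_algebraMap_eq (a : MvPolynomial (Fin 3) k) :
    eval (fun l => π (X l)) (map (algebraMap k R) a) = π a := by
  rw [eval_map, ← aeval_def]
  exact DFunLike.congr_fun (aeval_unique π).symm a

variable {π Φ} {f : MvPolynomial (Fin 3) k} {i j : Fin 3} {M : ℕ}

lemma coeff_zero_branch (h : IsChart f i j M Φ) (a : MvPolynomial (Fin 3) R) :
    (branch π Φ a).coeff 0 = eval (fun l => π (X l)) a := by
  induction a using MvPolynomial.induction_on with
  | C a => rw [← algebraMap_eq, AlgHom.commutes, Polynomial.algebraMap_eq, Polynomial.coeff_C_zero,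
      algebraMap_eq, eval_C]
  | add p q hp hq => rw [map_add, map_add, Polynomial.coeff_add, hp, hq]
  | mul_X p i hp =>
    rw [map_mul, map_mul, Polynomial.mul_coeff_zero, hp, branch, aeval_X, Polynomial.coeff_map,
      h.coeff_zero, eval_X]
    rfl

lemma X_pow_dvd_map (h : IsChart f i j M Φ) (hπ : π f = 0) :
    Polynomial.X ^ M ∣ (Φ f).map π.toRingHom := by
  have h1 := Polynomial.map_dvd π.toRingHom h.dvd_sub
  rw [Polynomial.map_pow, Polynomial.map_X, Polynomial.map_sub, Polynomial.map_C] at h1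
  rwa [show π.toRingHom f = 0 from hπ, Polynomial.C_0, sub_zero] at h1

lemma X_pow_dvd_branch (h : IsChart f i j M Φ) (hπ : π f = 0) :
    Polynomial.X ^ M ∣ branch π Φ (map (algebraMap k R) f) := by
  rw [branch_map]
  exact X_pow_dvd_map h hπ

lemma coeff_one_branch_X (h : IsChart f i j M Φ) (l : Fin 3) :
    (branch π Φ (X l)).coeff 1 = π (pderiv j f) * π (tangentField f i l) := by
  rw [branch, aeval_X, Polynomial.coeff_map, h.coeff_one]
  exact map_mul π _ _

lemma coeff_one_branch_linear (h : IsChart f i j M Φ) (w : Fin 3 → R) :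
    (branch π Φ (∑ l, C (w l) * X l)).coeff 1 =
      π (pderiv j f) * ∑ l, w l * π (tangentField f i l) := by
  rw [map_sum, Polynomial.finsetSum_coeff, Finset.mul_sum]
  refine Finset.sum_congr rfl fun l _ => ?_
  rw [map_mul, ← algebraMap_eq, AlgHom.commutes, Polynomial.algebraMap_eq, Polynomial.coeff_C_mul,
    coeff_one_branch_X h]
  ring

lemma sum_mul_map_tangentField (i : Fin 3) (w : Fin 3 → R) :
    ∑ l, w l * π (tangentField f i l) = crossProduct (fun l => π (pderiv l f)) w i := by
  fin_cases i <;> simp [tangentField, cross_apply, Fin.sum_univ_three] <;> ring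

lemma sum_coeff_mul_map_X_pow_eq_zero {p : ℕ} [ExpChar k p] [ExpChar R p] (n : ℕ)
    (h : IsChart f i j M Φ) (hπ : π f = 0) (hM : p ^ n ≤ M) {v : Fin 3 → MvPolynomial (Fin 3) k}
    (hv : f ∣ ∑ l, v l * X l ^ p ^ n) {m : ℕ} (hm : m < p ^ n) :
    ∑ l, π ((Φ (v l)).coeff m) * π (X l) ^ p ^ n = 0 := by
  have h1 : Polynomial.X ^ p ^ n ∣ (Φ (∑ l, v l * X l ^ p ^ n)).map π.toRingHom :=
    ((pow_dvd_pow _ hM).trans (X_pow_dvd_map h hπ)).trans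
      (Polynomial.map_dvd _ (map_dvd Φ hv))
  have h2 : Polynomial.X ^ p ^ n ∣
      ∑ l, (Φ (v l)).map π.toRingHom * Polynomial.C (π (X l) ^ p ^ n) := by
    refine (dvd_sub_right h1).1 ?_
    rw [map_sum, Polynomial.map_sum, ← Finset.sum_sub_distrib]
    refine Finset.dvd_sum fun l _ => ?_
    rw [map_mul, Polynomial.map_mul, ← mul_sub, map_pow, Polynomial.map_pow, Polynomial.C_pow,
      ← sub_pow_expChar_pow]
    refine (pow_dvd_pow_of_dvd ?_ _).mul_left _
    rw [Polynomial.X_dvd_iff, Polynomial.coeff_sub, Polynomial.coeff_map, h.coeff_zero,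
      Polynomial.coeff_C_zero]
    exact sub_self _
  have h3 := Polynomial.X_pow_dvd_iff.1 h2 m hm
  simp only [Polynomial.finsetSum_coeff, Polynomial.coeff_mul_C, Polynomial.coeff_map] at h3
  exact h3

end Branch

section Gluing

variable {k R : Type*} [CommRing k] [CommRing R] [Algebra k R]
  {π : MvPolynomial (Fin 3) k →ₐ[k] R} {f : MvPolynomial (Fin 3) k}

lemma sum_map_pderiv_mul_map_X (hf : f.IsHomogeneous 3) (hπ : π f = 0) :
    ∑ l, π (pderiv l f) * π (X l) = 0 := by
  have := congrArg π hf.sum_X_mul_pderiv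
  rw [map_nsmul, hπ, smul_zero, map_sum] at this
  simpa only [map_mul, mul_comm] using this

/-- The linear form `(e_j × P) · Y`. -/
noncomputable def crossLinear (P : Fin 3 → R) (j : Fin 3) : MvPolynomial (Fin 3) R :=
  ∑ l, C (crossProduct (Pi.single j 1) P l) * X l

lemma isHomogeneous_crossLinear (P : Fin 3 → R) (j : Fin 3) :
    (crossLinear P j).IsHomogeneous 1 :=
  IsHomogeneous.sum _ _ _ fun l _ => isHomogeneous_C_mul_X _ l

lemma eval_crossLinear (P : Fin 3 → R) (j : Fin 3) : eval P (crossLinear P j) = 0 := by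
  have := dot_cross_self (Pi.single j 1) P
  simpa [crossLinear, dotProduct, mul_comm] using this

lemma coeff_one_branch_crossLinear (hf : f.IsHomogeneous 3) (hπ : π f = 0)
    {Φ : MvPolynomial (Fin 3) k →ₐ[k] Polynomial (MvPolynomial (Fin 3) k)} {i j : Fin 3} {M : ℕ}
    (h : IsChart f i j M Φ) (b : Fin 3) :
    (branch π Φ (crossLinear (fun l => π (X l)) b)).coeff 1 =
      -(π (pderiv b f) * (π (X i) * π (pderiv j f))) := by
  rw [crossLinear, coeff_one_branch_linear h, sum_mul_map_tangentField]
  have he := sum_map_pderiv_mul_map_X hf hπ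
  rw [Fin.sum_univ_three] at he
  have : crossProduct (fun l => π (pderiv l f))
      (crossProduct (Pi.single b 1) fun l => π (X l)) i =
      (if i = b then 1 else 0) * (∑ l, π (pderiv l f) * π (X l)) - π (X i) * π (pderiv b f) := by
    rw [Fin.sum_univ_three]
    fin_cases b <;> fin_cases i <;> simp [cross_apply] <;> ring
  rw [this, Fin.sum_univ_three, he]
  ring

variable [IsDomain R]

/-- The leading coefficients of a homogeneous polynomial along the branches of different charts
are proportional to the powers of the velocities. -/
lemma coeff_branch_mul_pow_eq (hf : f.IsHomogeneous 3) (hπ : π f = 0) {i₀ j₀ : Fin 3}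
    (hij : i₀ ≠ j₀) (hi : π (X i₀) ≠ 0) (hj : π (pderiv j₀ f) ≠ 0) {M : ℕ}
    {Φ : Fin 3 → Fin 3 → MvPolynomial (Fin 3) k →ₐ[k] Polynomial (MvPolynomial (Fin 3) k)}
    (hΦ : ∀ i j, IsChart f i j M (Φ i j)) (hM : 2 ≤ M) {m : ℕ} (hm : m < M) {e : ℕ}
    {G : MvPolynomial (Fin 3) R} (hG : G.IsHomogeneous e)
    (hGm : ∀ i j, Polynomial.X ^ m ∣ branch π (Φ i j) G) (i j i' j' : Fin 3) :
    (branch π (Φ i j) G).coeff m * (π (X i') * π (pderiv j' f)) ^ m =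
      (branch π (Φ i' j') G).coeff m * (π (X i) * π (pderiv j f)) ^ m := by
  set P : Fin 3 → R := fun l => π (X l) with hP
  obtain ⟨s, H, -, hsP, hsH⟩ := exists_dvd_mul_sub_mul_pow (hf.map (algebraMap k R))
    (by rw [eval_map_algebraMap_eq, hπ]) hij hi (by rwa [pderiv_map, eval_map_algebraMap_eq])
    (coeff_zero_branch (hΦ i₀ j₀)) hM (X_pow_dvd_branch (hΦ i₀ j₀) hπ)
    (isHomogeneous_crossLinear P j₀) (eval_crossLinear P j₀) (by
      rw [coeff_one_branch_crossLinear hf hπ (hΦ i₀ j₀)]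
      exact neg_ne_zero.2 (mul_ne_zero hj (mul_ne_zero hi hj))) hm.le hG (hGm i₀ j₀)
  have key : ∀ i j, eval P s * (branch π (Φ i j) G).coeff m =
      eval P H * (-(π (pderiv j₀ f) * (π (X i) * π (pderiv j f)))) ^ m := by
    intro i j
    obtain ⟨g, hg⟩ := hGm i j
    obtain ⟨n, hn⟩ := Polynomial.X_dvd_iff.2
      ((coeff_zero_branch (hΦ i j) _).trans (eval_crossLinear P j₀))
    have h1 := coeff_one_branch_crossLinear hf hπ (hΦ i j) j₀
    rw [← hP, hn, Polynomial.coeff_X_mul] at h1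
    have h2 := Polynomial.X_pow_dvd_iff.1
      ((X_pow_dvd_branch (hΦ i j) hπ).trans (map_dvd (branch π (Φ i j)) hsH)) m hm
    rw [map_sub, map_mul, map_mul, map_pow, hn, hg, mul_pow, mul_left_comm,
      mul_left_comm _ (Polynomial.X ^ m), Polynomial.coeff_sub, Polynomial.coeff_X_pow_mul',
      Polynomial.coeff_X_pow_mul', if_pos le_rfl, Nat.sub_self, Polynomial.mul_coeff_zero,
      Polynomial.mul_coeff_zero, coeff_zero_branch (hΦ i j), coeff_zero_branch (hΦ i j),
      ← Polynomial.constantCoeff_apply (n ^ m), map_pow, Polynomial.constantCoeff_apply, h1,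
      if_pos le_rfl] at h2
    rw [hg, Polynomial.coeff_X_pow_mul', if_pos le_rfl, Nat.sub_self]
    exact sub_eq_zero.1 h2
  apply mul_left_cancel₀ hsP
  rw [← mul_assoc, ← mul_assoc, key, key, neg_pow, mul_pow, neg_pow, mul_pow]
  ring

end Gluing

section CrossDvd

lemma map_cross {A B : Type*} [CommRing A] [CommRing B] (π : A →+* B) (v w : Fin 3 → A)
    (l : Fin 3) :
    π (crossProduct v w l) = crossProduct (fun t => π (v t)) (fun t => π (w t)) l := by
  fin_cases l <;> simp [cross_apply]

lemma isHomogeneous_cross_map {k R : Type*} [CommRing k] [CommRing R] [Algebra k R] (c : Fin 3 → R)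
    {v : Fin 3 → MvPolynomial (Fin 3) k} {e : ℕ} (hv : ∀ l, (v l).IsHomogeneous e) (l : Fin 3) :
    (crossProduct (fun t => C (c t)) (fun t => map (algebraMap k R) (v t)) l).IsHomogeneous e := by
  have h : ∀ s t, (C (c s) * map (algebraMap k R) (v t)).IsHomogeneous e :=
    fun s t => ((hv t).map _).C_mul _
  fin_cases l <;> simp only [cross_apply]
  · exact (h 1 2).sub (h 2 1)
  · exact (h 2 0).sub (h 0 2)
  · exact (h 0 1).sub (h 1 0)

lemma coeff_branch_cross_map {k R : Type*} [CommRing k] [CommRing R] [Algebra k R]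
    (π : MvPolynomial (Fin 3) k →ₐ[k] R)
    (Φ : MvPolynomial (Fin 3) k →ₐ[k] Polynomial (MvPolynomial (Fin 3) k))
    (v : Fin 3 → MvPolynomial (Fin 3) k) (l : Fin 3) (m : ℕ) :
    (branch π Φ (crossProduct (fun t => C (π (v t)))
      (fun t => map (algebraMap k R) (v t)) l)).coeff m =
      π (crossProduct v (fun t => (Φ (v t)).coeff m) l) := by
  have h : ∀ s t, (branch π Φ (C (π (v s)) * map (algebraMap k R) (v t))).coeff m =
      π (v s * (Φ (v t)).coeff m) := by
    intro s t
    rw [map_mul, branch_map, ← algebraMap_eq, AlgHom.commutes, Polynomial.algebraMap_eq,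
      Polynomial.coeff_C_mul, Polynomial.coeff_map, map_mul]
    rfl
  fin_cases l <;> simp only [cross_apply] <;>
    exact (congrArg (fun F => Polynomial.coeff F m) (map_sub _ _ _)).trans
      ((Polynomial.coeff_sub _ _ _).trans (by rw [h, h, ← map_sub]; rfl))

variable {k : Type*} [Field k] {f : MvPolynomial (Fin 3) k}

lemma not_dvd_X (hf : f.IsHomogeneous 3) (hf0 : f ≠ 0) (l : Fin 3) : ¬ f ∣ X l :=
  not_dvd_of_totalDegree_lt (X_ne_zero l) (by rw [hf.totalDegree hf0, totalDegree_X]; norm_num)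

variable [IsAlgClosed k]

lemma exists_not_dvd_pderiv (hf : f.IsHomogeneous 3)
    (hsmooth : ∀ a : Fin 3 → k, eval a f = 0 → (∀ i, eval a (pderiv i f) = 0) → a = 0) :
    ∃ j, ¬ f ∣ pderiv j f := by
  by_contra! hcon
  obtain ⟨a, ha, ha0⟩ := exists_eval_ne_zero_of_not_dvd (prime_of_smooth hf hsmooth)
    (not_dvd_X hf (ne_zero_of_smooth hsmooth) 0)
  refine ha0 ?_
  rw [hsmooth a ha fun i => ?_]
  · simp
  · obtain ⟨r, hr⟩ := hcon i
    rw [hr, map_mul, ha, zero_mul]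

variable {p : ℕ} [ExpChar k p]

/-- Along every branch the tuple `v` stays proportional to its initial value up to order `q`,
if `v` is a relation of small degree between the `q`-th powers of the variables on the curve. -/
lemma dvd_cross_coeff (hf : f.IsHomogeneous 3)
    (hsmooth : ∀ a : Fin 3 → k, eval a f = 0 → (∀ i, eval a (pderiv i f) = 0) → a = 0)
    {n M e : ℕ}
    {Φ : Fin 3 → Fin 3 → MvPolynomial (Fin 3) k →ₐ[k] Polynomial (MvPolynomial (Fin 3) k)}
    (hΦ : ∀ i j, IsChart f i j M (Φ i j)) (hM : p ^ n + 2 ≤ M) (he : 2 * e < p ^ n)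
    {v : Fin 3 → MvPolynomial (Fin 3) k} (hv : ∀ l, (v l).IsHomogeneous e)
    (hfv : f ∣ ∑ l, v l * X l ^ p ^ n) (m : ℕ) (hm : m < p ^ n) (i j l : Fin 3) :
    f ∣ crossProduct v (fun t => (Φ i j (v t)).coeff m) l := by
  have hprime := prime_of_smooth hf hsmooth
  have hf0 := hprime.ne_zero
  have : (Ideal.span {f}).IsPrime := (Ideal.span_singleton_prime hf0).2 hprime
  let R := MvPolynomial (Fin 3) k ⧸ Ideal.span {f}
  let π : MvPolynomial (Fin 3) k →ₐ[k] R := Ideal.Quotient.mkₐ k (Ideal.span {f})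
  have hR : ∀ a, π a = 0 ↔ f ∣ a := fun a =>
    Ideal.Quotient.eq_zero_iff_mem.trans Ideal.mem_span_singleton
  have hπ : π f = 0 := (hR f).2 dvd_rfl
  have : ExpChar R p := expChar_of_injective_algebraMap (algebraMap k R).injective p
  obtain ⟨j₀, hj₀⟩ := exists_not_dvd_pderiv hf hsmooth
  obtain ⟨i₀, hi₀⟩ : ∃ i₀, i₀ ≠ j₀ := ⟨j₀ + 1, by fin_cases j₀ <;> decide⟩
  induction m using Nat.strong_induction_on generalizing i j l with
  | _ m ih =>
  let θ : Fin 3 × Fin 3 × Fin 3 → MvPolynomial (Fin 3) k :=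
    fun t => (X t.1 * pderiv t.2.1 f) ^ m * X t.2.2 ^ p ^ n
  let H : Fin 3 × Fin 3 × Fin 3 → MvPolynomial (Fin 3) k :=
    fun t => crossProduct v (fun s => (Φ t.1 t.2.1 (v s)).coeff m) t.2.2
  refine dvd_of_compatible_fractions hprime hf θ H (0, j₀, 0) (d := (1 + 2) * m + 1 * p ^ n)
    ?_ ?_ ?_ ?_ ?_ (i, j, l)
  · exact (((isHomogeneous_X _ _).mul hf.pderiv).pow m).mul ((isHomogeneous_X _ _).pow _)
  · have h1 : ∀ s, (v s).totalDegree ≤ e := fun s => (hv s).totalDegree_le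
    have h2 : ∀ s, ((Φ 0 j₀ (v s)).coeff m).totalDegree ≤ e + 3 * m :=
      fun s => (hΦ 0 j₀).totalDegree_le e (v s) (hv s) m
    have h3 : ∀ s t, (v s * (Φ 0 j₀ (v t)).coeff m).totalDegree ≤ e + (e + 3 * m) :=
      fun s t => (totalDegree_mul _ _).trans (add_le_add (h1 s) (h2 t))
    have h4 : (H (0, j₀, 0)).totalDegree ≤ e + (e + 3 * m) := by
      simp only [H, cross_apply]
      exact (totalDegree_sub _ _).trans (max_le (h3 1 2) (h3 2 1))
    omega
  · intro h
    rcases hprime.dvd_or_dvd h with h | h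
    · rcases hprime.dvd_or_dvd (hprime.dvd_of_dvd_pow h) with h | h
      · exact not_dvd_X hf hf0 _ h
      · exact hj₀ h
    · exact not_dvd_X hf hf0 _ (hprime.dvd_of_dvd_pow h)
  · rintro ⟨i, j, l⟩
    have h1 : ∀ i j, π (X l) ^ p ^ n * π (H (i, j, 0)) = π (X 0) ^ p ^ n * π (H (i, j, l)) := by
      intro i j
      have h2 := sum_coeff_mul_map_X_pow_eq_zero n (hΦ i j) hπ (by omega) hfv hm
      have h3 := sum_coeff_mul_map_X_pow_eq_zero n (hΦ i j) hπ (by omega) hfv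
        (m := 0) (by omega)
      simp only [(hΦ i j).coeff_zero] at h3
      have h4 := mul_cross_eq_mul_cross h3 h2 l 0
      have h5 := map_cross π.toRingHom v (fun s => (Φ i j (v s)).coeff m)
      exact (congrArg _ (h5 0)).trans (h4.trans (congrArg _ (h5 l).symm))
    have h2 := coeff_branch_mul_pow_eq hf hπ hi₀ (mt (hR _).1 (not_dvd_X hf hf0 i₀))
      (mt (hR _).1 hj₀) hΦ (by omega) (by omega)
      (isHomogeneous_cross_map (fun t => π (v t)) hv 0) (m := m) (fun i j => by
        rw [Polynomial.X_pow_dvd_iff]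
        intro m' hm'
        rw [coeff_branch_cross_map, hR]
        exact ih m' hm' (hm'.trans hm) i j 0) 0 j₀ i j
    rw [coeff_branch_cross_map, coeff_branch_cross_map] at h2
    rw [← hR]
    simp only [θ, map_sub, map_mul, map_pow]
    have h3 := h1 i j
    simp only [H] at h3 ⊢
    linear_combination π (X l) ^ p ^ n * h2 + (π (X 0) * π (pderiv j₀ f)) ^ m * h3
  · intro a ha h
    by_contra hne
    obtain ⟨i, hi⟩ := Function.ne_iff.1 hne
    refine hne (hsmooth a ha fun j => ?_)
    have := h (i, j, i)
    simp only [θ, map_mul, map_pow, eval_X] at this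
    by_contra hj
    exact mul_ne_zero (pow_ne_zero m (mul_ne_zero hi hj)) (pow_ne_zero _ hi) this

end CrossDvd

section LinearForm

variable {k : Type*} [Field k]

/-- The linear form with coefficient vector `w`. -/
noncomputable def linearForm (w : Fin 3 → k) : MvPolynomial (Fin 3) k :=
  ∑ l, C (w l) * X l

lemma isHomogeneous_linearForm (w : Fin 3 → k) : (linearForm w).IsHomogeneous 1 :=
  IsHomogeneous.sum _ _ _ fun l _ => isHomogeneous_C_mul_X _ l

lemma eval_linearForm (w a : Fin 3 → k) : eval a (linearForm w) = dotProduct w a := by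
  simp [linearForm, dotProduct]

lemma linearForm_ne_zero {w : Fin 3 → k} (hw : w ≠ 0) : linearForm w ≠ 0 := by
  obtain ⟨i, hi⟩ := Function.ne_iff.1 hw
  intro h
  have := eval_linearForm w (Pi.single i 1)
  rw [h, map_zero, dotProduct_single, mul_one] at this
  exact hi this.symm

lemma not_dvd_of_isHomogeneous_lt {f g : MvPolynomial (Fin 3) k} {d e : ℕ}
    (hf : f.IsHomogeneous d) (hf0 : f ≠ 0) (hg : g.IsHomogeneous e) (hg0 : g ≠ 0) (h : e < d) :
    ¬ f ∣ g :=
  not_dvd_of_totalDegree_lt hg0 (by rwa [hf.totalDegree hf0, hg.totalDegree hg0])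

end LinearForm

section PointBranch

variable {k : Type*} [Field k] {f : MvPolynomial (Fin 3) k} {P : Fin 3 → k}

/-- The gradient of `f` at the point `P`. -/
noncomputable def gradAt (f : MvPolynomial (Fin 3) k) (P : Fin 3 → k) : Fin 3 → k :=
  fun l => eval P (pderiv l f)

lemma gradAt_dotProduct_self (hf : f.IsHomogeneous 3) (hP : eval P f = 0) :
    dotProduct (gradAt f P) P = 0 := by
  have h : aeval P f = 0 := hP
  have h1 := sum_map_pderiv_mul_map_X hf h
  simp only [aeval_X] at h1
  exact h1

lemma gradAt_ne_zero
    (hsmooth : ∀ a : Fin 3 → k, eval a f = 0 → (∀ i, eval a (pderiv i f) = 0) → a = 0)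
    (hP0 : P ≠ 0) (hP : eval P f = 0) : gradAt f P ≠ 0 :=
  fun h => hP0 (hsmooth P hP fun i => congrFun h i)

lemma exists_ne_gradAt_ne_zero (hf : f.IsHomogeneous 3)
    (hsmooth : ∀ a : Fin 3 → k, eval a f = 0 → (∀ i, eval a (pderiv i f) = 0) → a = 0)
    (hP0 : P ≠ 0) (hP : eval P f = 0) : ∃ i j, i ≠ j ∧ P i ≠ 0 ∧ gradAt f P j ≠ 0 := by
  by_contra! hcon
  obtain ⟨i, hi⟩ := Function.ne_iff.1 hP0
  obtain ⟨j, hj⟩ := Function.ne_iff.1 (gradAt_ne_zero hsmooth hP0 hP)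
  have h := gradAt_dotProduct_self hf hP
  rw [dotProduct, Finset.sum_eq_single i (fun b _ hb => by rw [hcon i b hb.symm hi, zero_mul])
    (by simp)] at h
  rcases mul_eq_zero.1 h with h | h
  · rcases eq_or_ne i j with rfl | hij
    · exact hj h
    · exact hj (hcon i j hij hi)
  · exact hi h

lemma coeff_one_branch_linearForm {i j : Fin 3} {M : ℕ}
    {Φ : MvPolynomial (Fin 3) k →ₐ[k] Polynomial (MvPolynomial (Fin 3) k)}
    (h : IsChart f i j M Φ) (w : Fin 3 → k) :
    (branch (aeval P) Φ (linearForm w)).coeff 1 =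
      gradAt f P j * crossProduct (gradAt f P) w i := by
  rw [linearForm, coeff_one_branch_linear h, sum_mul_map_tangentField]
  rfl

lemma exists_dvd_of_X_pow_dvd_branch (hf : f.IsHomogeneous 3) (hP : eval P f = 0) {i j : Fin 3}
    (hij : i ≠ j) (hi : P i ≠ 0) (hj : gradAt f P j ≠ 0) {M : ℕ}
    {Φ : MvPolynomial (Fin 3) k →ₐ[k] Polynomial (MvPolynomial (Fin 3) k)}
    (h : IsChart f i j M Φ) (hM : 2 ≤ M) {w : Fin 3 → k} (hwP : dotProduct w P = 0)
    (hw : crossProduct (gradAt f P) w ≠ 0) {m e : ℕ} (hm : m ≤ M) {G : MvPolynomial (Fin 3) k}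
    (hG : G.IsHomogeneous e) (hGm : Polynomial.X ^ m ∣ branch (aeval P) Φ G) :
    ∃ s H, (∃ d, s.IsHomogeneous d) ∧ eval P s ≠ 0 ∧ f ∣ s * G - H * linearForm w ^ m := by
  have hπ : aeval P f = 0 := hP
  refine exists_dvd_mul_sub_mul_pow hf hP hij hi hj (ψ := branch (aeval P) Φ)
    (fun a => ?_) hM ?_ (isHomogeneous_linearForm w) ?_ ?_ hm hG hGm
  · rw [coeff_zero_branch h]
    simp
  · have := X_pow_dvd_branch (π := aeval P) h hπ
    rwa [Algebra.algebraMap_self, MvPolynomial.map_id] at this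
  · rw [eval_linearForm, hwP]
  · rw [coeff_one_branch_linearForm h]
    refine mul_ne_zero hj fun h0 => hw ?_
    have h1 := gradAt_dotProduct_self hf hP
    have h2 : ∀ a, P i * crossProduct (gradAt f P) w a = 0 := by
      intro a
      have h3 := mul_cross_eq_mul_cross (v := gradAt f P) (w := w) (x := P) h1 hwP i a
      rw [h3, h0, mul_zero]
    funext a
    exact (mul_eq_zero.1 (h2 a)).resolve_left hi

lemma exists_dvd_mul_tangent_sub (hf : f.IsHomogeneous 3)
    (hsmooth : ∀ a : Fin 3 → k, eval a f = 0 → (∀ i, eval a (pderiv i f) = 0) → a = 0)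
    (hP0 : P ≠ 0) (hP : eval P f = 0) {w : Fin 3 → k} (hwP : dotProduct w P = 0)
    (hw : crossProduct (gradAt f P) w ≠ 0) :
    ∃ s H, (∃ d, s.IsHomogeneous d) ∧ eval P s ≠ 0 ∧
      f ∣ s * linearForm (gradAt f P) - H * linearForm w ^ 2 := by
  obtain ⟨i, j, hij, hi, hj⟩ := exists_ne_gradAt_ne_zero hf hsmooth hP0 hP
  obtain ⟨Φ, hΦ⟩ := exists_isChart hf i j 2
  refine exists_dvd_of_X_pow_dvd_branch hf hP hij hi hj hΦ le_rfl hwP hw le_rfl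
    (isHomogeneous_linearForm _) (Polynomial.X_pow_dvd_iff.2 fun m hm => ?_)
  interval_cases m
  · rw [coeff_zero_branch hΦ]
    simpa [eval_linearForm] using gradAt_dotProduct_self hf hP
  · rw [coeff_one_branch_linearForm hΦ, cross_self, Pi.zero_apply, mul_zero]

variable [IsAlgClosed k] {p : ℕ} [ExpChar k p]

lemma exists_dvd_mul_combination_sub (hf : f.IsHomogeneous 3)
    (hsmooth : ∀ a : Fin 3 → k, eval a f = 0 → (∀ i, eval a (pderiv i f) = 0) → a = 0)
    (hP0 : P ≠ 0) (hP : eval P f = 0) {w : Fin 3 → k} (hwP : dotProduct w P = 0)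
    (hw : crossProduct (gradAt f P) w ≠ 0) {n e : ℕ} (he : 2 * e < p ^ n)
    {v : Fin 3 → MvPolynomial (Fin 3) k} (hv : ∀ l, (v l).IsHomogeneous e)
    (hfv : f ∣ ∑ l, v l * X l ^ p ^ n) {l₀ : Fin 3} (hvP : eval P (v l₀) ≠ 0) {c : Fin 3 → k}
    (hc : ∑ l, c l * eval P (v l) = 0) :
    ∃ s H, (∃ d, s.IsHomogeneous d) ∧ eval P s ≠ 0 ∧
      f ∣ s * (∑ l, C (c l) * v l) - H * linearForm w ^ p ^ n := by
  obtain ⟨i, j, hij, hi, hj⟩ := exists_ne_gradAt_ne_zero hf hsmooth hP0 hP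
  choose Φ hΦ using fun i j => exists_isChart hf i j (p ^ n + 2)
  refine exists_dvd_of_X_pow_dvd_branch hf hP hij hi hj (hΦ i j) (by omega) hwP hw (by omega)
    (e := 0 + e) (IsHomogeneous.sum _ _ _ fun l _ => (isHomogeneous_C _ _).mul (hv l))
    (Polynomial.X_pow_dvd_iff.2 fun m hm => ?_)
  have h0 : ∀ l, crossProduct (fun t => eval P (v t))
      (fun t => eval P ((Φ i j (v t)).coeff m)) l = 0 := by
    intro l
    obtain ⟨g, hg⟩ := dvd_cross_coeff hf hsmooth hΦ le_rfl he hv hfv m hm i j l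
    rw [← map_cross, hg, map_mul, hP, zero_mul]
  have h1 : ∀ t, branch (aeval P) (Φ i j) (v t) = (Φ i j (v t)).map (aeval P).toRingHom := by
    intro t
    have := branch_map (aeval P) (Φ i j) (v t)
    rwa [Algebra.algebraMap_self, MvPolynomial.map_id] at this
  have h2 : (branch (aeval P) (Φ i j) (∑ l, C (c l) * v l)).coeff m =
      ∑ l, c l * eval P ((Φ i j (v l)).coeff m) := by
    rw [map_sum, Polynomial.finsetSum_coeff]
    refine Finset.sum_congr rfl fun l _ => ?_
    rw [map_mul, ← algebraMap_eq, AlgHom.commutes, Polynomial.algebraMap_eq,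
      Polynomial.coeff_C_mul, h1, Polynomial.coeff_map]
    rfl
  rw [h2]
  have h3 := h0 0
  have h4 := h0 1
  have h5 := h0 2
  rw [Fin.sum_univ_three] at hc ⊢
  simp only [cross_apply, Matrix.cons_val_zero, Matrix.cons_val_one, Matrix.cons_val] at h3 h4 h5
  refine (mul_eq_zero.1 ?_).resolve_left hvP
  fin_cases l₀
  · simp only [Fin.zero_eta]
    linear_combination eval P ((Φ i j (v 0)).coeff m) * hc + c 1 * h5 - c 2 * h4
  · simp only [Fin.mk_one]
    linear_combination eval P ((Φ i j (v 1)).coeff m) * hc - c 0 * h5 + c 2 * h3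
  · simp only [Fin.reduceFinMk]
    linear_combination eval P ((Φ i j (v 2)).coeff m) * hc + c 0 * h4 - c 1 * h3

end PointBranch

section Points

variable {k : Type*} [Field k] {f : MvPolynomial (Fin 3) k}

lemma eval_smul_of_isHomogeneous {d : ℕ} {g : MvPolynomial (Fin 3) k} (hg : g.IsHomogeneous d)
    (c : k) (P : Fin 3 → k) : eval (c • P) g = c ^ d * eval P g :=
  aeval_mul_of_isHomogeneous hg c P

lemma eval_smul_add_smul (hf : f.IsHomogeneous 3) (P Q : Fin 3 → k) (s t : k) :
    eval (s • P + t • Q) f = s ^ 3 * eval P f + s ^ 2 * t * dotProduct (gradAt f P) Q +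
      s * t ^ 2 * dotProduct (gradAt f Q) P + t ^ 3 * eval Q f := by
  have h := aeval_add_of_isHomogeneous_three hf (s • P) (t • Q)
  simp only [aeval_eq_eval] at h
  refine Eq.trans h ?_
  have h2 : ∀ l, (pderiv l f).IsHomogeneous 2 := fun l => hf.pderiv
  simp only [eval_smul_of_isHomogeneous hf, eval_smul_of_isHomogeneous (h2 _), dotProduct, gradAt,
    Finset.mul_sum, Pi.smul_apply, smul_eq_mul]
  congr 2
  · congr 1
    exact Finset.sum_congr rfl fun l _ => by ring
  · exact Finset.sum_congr rfl fun l _ => by ring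

lemma crossProduct_cross_ne_zero {g h P Q : Fin 3 → k}
    (H : dotProduct g Q * dotProduct h P - dotProduct P g * dotProduct h Q ≠ 0) :
    crossProduct g (crossProduct P Q) ≠ 0 := by
  intro h0
  have := congrArg (dotProduct h) h0
  rw [cross_cross_eq_smul_sub_smul', dotProduct_sub, dotProduct_smul, dotProduct_smul,
    dotProduct_zero] at this
  exact H this

lemma exists_eq_smul_add_smul {P Q a : Fin 3 → k} {g h : Fin 3 → k} (hgP : dotProduct g P = 0)
    (hgQ : dotProduct g Q ≠ 0) (hhQ : dotProduct h Q = 0) (hhP : dotProduct h P ≠ 0)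
    (ha : dotProduct (crossProduct P Q) a = 0) : ∃ s t : k, a = s • P + t • Q := by
  have hdet : Matrix.det ![a, P, Q] = 0 := by
    rw [← triple_product_eq_det, dotProduct_comm, ha]
  obtain ⟨c, hc0, hc⟩ := Matrix.exists_vecMul_eq_zero_iff.2 hdet
  have hc' : c 0 • a + c 1 • P + c 2 • Q = 0 := by
    rw [← hc]
    funext l
    simp [Matrix.vecMul, dotProduct, Fin.sum_univ_three]
  have h0 : c 0 ≠ 0 := by
    intro h0
    apply hc0
    rw [h0, zero_smul, zero_add] at hc'
    have h1 := congrArg (dotProduct g) hc'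
    have h2 := congrArg (dotProduct h) hc'
    simp only [dotProduct_add, dotProduct_smul, hgP, hhQ, mul_zero, zero_add, add_zero,
      dotProduct_zero, smul_eq_mul, mul_eq_zero, hgQ, hhP, or_false] at h1 h2
    funext l
    fin_cases l
    · exact h0
    · exact h2
    · exact h1
  refine ⟨-(c 1 / c 0), -(c 2 / c 0), ?_⟩
  funext l
  have := congrFun hc' l
  simp only [Pi.add_apply, Pi.smul_apply, smul_eq_mul, Pi.zero_apply] at this ⊢
  field_simp
  linear_combination this

lemma exists_ne_zero_dotProduct_pair_eq_zero (u v : Fin 3 → k) :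
    ∃ w : Fin 3 → k, w ≠ 0 ∧ dotProduct u w = 0 ∧ dotProduct v w = 0 := by
  obtain ⟨w, hw, h⟩ := Matrix.exists_mulVec_eq_zero_iff.2
    (Matrix.det_eq_zero_of_row_eq_zero (A := Matrix.of ![u, v, 0]) 2 fun j => by simp)
  exact ⟨w, hw, congrFun h 0, congrFun h 1⟩

lemma exists_eq_smul_of_cross_eq_zero {a w : Fin 3 → k} (hw : w ≠ 0)
    (h : crossProduct a w = 0) : ∃ c : k, a = c • w := by
  obtain ⟨i, hi⟩ := Function.ne_iff.1 hw
  have h0 := congrFun h 0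
  have h1 := congrFun h 1
  have h2 := congrFun h 2
  simp only [cross_apply, Matrix.cons_val_zero, Matrix.cons_val_one, Matrix.cons_val,
    Pi.zero_apply] at h0 h1 h2 hi
  refine ⟨a i / w i, ?_⟩
  funext l
  simp only [Pi.smul_apply, smul_eq_mul]
  field_simp
  fin_cases i <;> fin_cases l <;> simp <;>
    first | linear_combination h0 | linear_combination h1 | linear_combination h2 |
      linear_combination -h0 | linear_combination -h1 | linear_combination -h2

variable [IsAlgClosed k]

/-- Two points on a smooth cubic, outside of a given curve, such that neither lies on the tangent
line at the other. -/
lemma exists_two_points (hf : f.IsHomogeneous 3)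
    (hsmooth : ∀ a : Fin 3 → k, eval a f = 0 → (∀ i, eval a (pderiv i f) = 0) → a = 0)
    {g : MvPolynomial (Fin 3) k} (hg : ¬ f ∣ g) :
    ∃ P Q : Fin 3 → k, eval P f = 0 ∧ eval Q f = 0 ∧ eval P g ≠ 0 ∧ eval Q g ≠ 0 ∧
      dotProduct (gradAt f P) Q ≠ 0 ∧ dotProduct (gradAt f Q) P ≠ 0 := by
  have hprime := prime_of_smooth hf hsmooth
  have hf0 := hprime.ne_zero
  have hlin : ∀ w, w ≠ 0 → ¬ f ∣ linearForm w := fun w hw =>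
    not_dvd_of_isHomogeneous_lt hf hf0 (isHomogeneous_linearForm w) (linearForm_ne_zero hw)
      (by norm_num)
  obtain ⟨R, hR, hR0⟩ := exists_eval_ne_zero_of_not_dvd hprime (not_dvd_X hf hf0 0)
  have hR1 : gradAt f R ≠ 0 := gradAt_ne_zero hsmooth (by rintro rfl; simp at hR0) hR
  obtain ⟨P, hP, hP0⟩ := exists_eval_ne_zero_of_not_dvd hprime
    (hprime.not_dvd_mul hg (hlin _ hR1))
  rw [map_mul, eval_linearForm] at hP0
  have hP1 : P ≠ 0 := by
    rintro rfl
    simp at hP0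
  let μ : MvPolynomial (Fin 3) k := ∑ l, pderiv l f * C (P l)
  have hμ : ∀ Y, eval Y μ = dotProduct (gradAt f Y) P := fun Y => by
    simp [μ, dotProduct, gradAt]
  have hμ0 : μ ≠ 0 := by
    intro h
    have := hμ R
    rw [h, map_zero] at this
    exact right_ne_zero_of_mul hP0 this.symm
  have hμ1 : ¬ f ∣ μ := not_dvd_of_isHomogeneous_lt (e := 2 + 0) hf hf0
    (IsHomogeneous.sum _ _ _ fun l _ => hf.pderiv.mul (isHomogeneous_C _ _)) hμ0 (by norm_num)
  obtain ⟨Q, hQ, hQ0⟩ := exists_eval_ne_zero_of_not_dvd hprime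
    (hprime.not_dvd_mul hg (hprime.not_dvd_mul hμ1 (hlin _ (gradAt_ne_zero hsmooth hP1 hP))))
  rw [map_mul, map_mul, hμ, eval_linearForm] at hQ0
  exact ⟨P, Q, hP, hQ, left_ne_zero_of_mul hP0, left_ne_zero_of_mul hQ0,
    right_ne_zero_of_mul (right_ne_zero_of_mul hQ0), left_ne_zero_of_mul (right_ne_zero_of_mul hQ0)⟩

end Points

section Vanishing

variable {k : Type*} [Field k] [IsAlgClosed k] {f : MvPolynomial (Fin 3) k}
  {p : ℕ} [ExpChar k p]

/-- A relation of small degree between `q`-th powers of the variables on a smooth cubic satisfies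
a linear relation with constant coefficients. -/
lemma exists_linear_relation (hf : f.IsHomogeneous 3)
    (hsmooth : ∀ a : Fin 3 → k, eval a f = 0 → (∀ i, eval a (pderiv i f) = 0) → a = 0)
    {n e : ℕ} (he : 2 * e < p ^ n) {v : Fin 3 → MvPolynomial (Fin 3) k}
    (hv : ∀ l, (v l).IsHomogeneous e) (hfv : f ∣ ∑ l, v l * X l ^ p ^ n) {l₀ : Fin 3}
    (hv0 : ¬ f ∣ v l₀) :
    ∃ c : Fin 3 → k, c ≠ 0 ∧ f ∣ ∑ l, C (c l) * v l := by
  have hprime := prime_of_smooth hf hsmooth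
  have hf0 := hprime.ne_zero
  obtain ⟨P₀, P₁, h0, h1, hv₀, hv₁, hA, hB⟩ := exists_two_points hf hsmooth hv0
  have hP0 : P₀ ≠ 0 := by
    rintro rfl
    simp at hB
  have hP1 : P₁ ≠ 0 := by
    rintro rfl
    simp at hA
  obtain ⟨c, hc, hc0, hc1⟩ := exists_ne_zero_dotProduct_pair_eq_zero (fun l => eval P₀ (v l))
    (fun l => eval P₁ (v l))
  refine ⟨c, hc, ?_⟩
  have he0 := gradAt_dotProduct_self hf h0
  have he1 := gradAt_dotProduct_self hf h1
  set A := dotProduct (gradAt f P₀) P₁ with hAdef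
  set B := dotProduct (gradAt f P₁) P₀ with hBdef
  set w := crossProduct P₀ P₁ with hw
  have hw0 : dotProduct w P₀ = 0 := by rw [dotProduct_comm, hw, dot_self_cross]
  have hw1 : dotProduct w P₁ = 0 := by rw [dotProduct_comm, hw, dot_cross_self]
  have hfst : ∀ s t : k, eval (s • P₀ + t • P₁) f = s * t * (s * A + t * B) := by
    intro s t
    rw [eval_smul_add_smul hf, h0, h1]
    ring
  set P₂ := B • P₀ + (-A) • P₁ with hP2def
  have h2 : eval P₂ f = 0 := by
    rw [hfst]
    ring
  have hP2 : P₂ ≠ 0 := by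
    intro h
    have := congrArg (dotProduct (gradAt f P₀)) h
    simp only [hP2def, dotProduct_add, dotProduct_smul, he0, ← hAdef, dotProduct_zero, smul_eq_mul,
      mul_zero, zero_add, neg_mul, neg_eq_zero, mul_self_eq_zero] at this
    exact hA this
  have hw2 : dotProduct w P₂ = 0 := by
    rw [hP2def, dotProduct_add, dotProduct_smul, dotProduct_smul, hw0, hw1, smul_zero, smul_zero,
      add_zero]
  have hg2 : dotProduct (gradAt f P₂) P₁ = -(A * B ^ 2) := by
    have e1 := eval_smul_add_smul hf P₂ P₁ 1 1
    have e2 : (1 : k) • P₂ + (1 : k) • P₁ = B • P₀ + (1 - A) • P₁ := by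
      rw [hP2def]
      module
    have e3 : dotProduct (gradAt f P₁) P₂ = B ^ 2 := by
      simp only [hP2def, dotProduct_add, dotProduct_smul, he1, ← hBdef, smul_eq_mul]
      ring
    rw [e2, hfst, h1, h2, e3] at e1
    linear_combination -e1
  obtain ⟨s₀, C₀, ⟨d₀, hs₀⟩, hsP₀, hd₀⟩ := exists_dvd_mul_combination_sub hf hsmooth hP0 h0 hw0
    (crossProduct_cross_ne_zero (h := gradAt f P₁) (by
      rw [dotProduct_comm P₀, he0, zero_mul, sub_zero, ← hAdef, ← hBdef]
      exact mul_ne_zero hA hB)) he hv hfv hv₀ (c := c)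
    (by simpa only [dotProduct, mul_comm] using hc0)
  obtain ⟨s₁, C₁, ⟨d₁, hs₁⟩, hsP₁, hd₁⟩ := exists_dvd_mul_combination_sub hf hsmooth hP1 h1 hw1
    (crossProduct_cross_ne_zero (h := gradAt f P₀) (by
      rw [dotProduct_comm P₀, he1, zero_mul, zero_sub, ← hAdef, ← hBdef]
      exact neg_ne_zero.2 (mul_ne_zero hB hA))) he hv hfv hv₁ (c := c)
    (by simpa only [dotProduct, mul_comm] using hc1)
  obtain ⟨s₂, C₂, ⟨d₂, hs₂⟩, hsP₂, hd₂⟩ := exists_dvd_mul_tangent_sub hf hsmooth hP2 h2 hw2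
    (crossProduct_cross_ne_zero (h := gradAt f P₁) (by
      rw [he1, mul_zero, sub_zero, hg2, ← hBdef]
      exact mul_ne_zero (neg_ne_zero.2 (mul_ne_zero hA (pow_ne_zero 2 hB))) hB))
  set G := ∑ l, C (c l) * v l with hG
  set T := linearForm (gradAt f P₂) with hT
  set N := linearForm w with hN
  have hT0 : ¬ f ∣ T := not_dvd_of_isHomogeneous_lt hf hf0 (isHomogeneous_linearForm _)
    (linearForm_ne_zero (gradAt_ne_zero hsmooth hP2 h2)) (by norm_num)
  have hwne : w ≠ 0 := by
    intro h
    have := crossProduct_cross_ne_zero (g := gradAt f P₀) (h := gradAt f P₁) (P := P₀) (Q := P₁) (by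
      rw [dotProduct_comm P₀, he0, zero_mul, sub_zero, ← hAdef, ← hBdef]
      exact mul_ne_zero hA hB)
    rw [← hw, h, map_zero] at this
    exact this rfl
  have hN0 : ¬ f ∣ N := not_dvd_of_isHomogeneous_lt hf hf0 (isHomogeneous_linearForm _)
    (linearForm_ne_zero hwne) (by norm_num)
  have hdeg : G.totalDegree ≤ 0 + e := IsHomogeneous.totalDegree_le
    (IsHomogeneous.sum _ _ _ fun l _ => (isHomogeneous_C _ _).mul (hv l))
  have hdegT : T.totalDegree ≤ 1 := (isHomogeneous_linearForm _).totalDegree_le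
  have hpos : 0 < p ^ n := by omega
  have key := dvd_of_compatible_fractions hprime hf
    ![N ^ (2 * p ^ n), s₀ ^ 2, s₁ ^ 2, s₂ ^ p ^ n]
    ![G ^ 2 * T ^ p ^ n, C₀ ^ 2 * T ^ p ^ n, C₁ ^ 2 * T ^ p ^ n, G ^ 2 * C₂ ^ p ^ n] 0
    (d := 1 * (2 * p ^ n)) ((isHomogeneous_linearForm w).pow _) ?_
    (fun h => hN0 (hprime.dvd_of_dvd_pow h)) ?_ ?_ 0
  · rcases hprime.dvd_or_dvd key with h | h
    · exact hprime.dvd_of_dvd_pow h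
    · exact absurd (hprime.dvd_of_dvd_pow h) hT0
  · have e1 := totalDegree_mul (G ^ 2) (T ^ p ^ n)
    have e2 := totalDegree_pow G 2
    have e3 := totalDegree_pow T (p ^ n)
    have e4 : p ^ n * T.totalDegree ≤ p ^ n * 1 := Nat.mul_le_mul_left _ hdegT
    simp only [Matrix.cons_val_zero]
    omega
  · intro t
    have hsq : ∀ s Cc : MvPolynomial (Fin 3) k, f ∣ s * G - Cc * N ^ p ^ n →
        f ∣ s ^ 2 * (G ^ 2 * T ^ p ^ n) - N ^ (2 * p ^ n) * (Cc ^ 2 * T ^ p ^ n) := by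
      intro s Cc h
      convert h.mul_right ((s * G + Cc * N ^ p ^ n) * T ^ p ^ n) using 1
      ring
    fin_cases t
    · simp
    · exact hsq _ _ hd₀
    · exact hsq _ _ hd₁
    · have := (hd₂.trans (sub_dvd_pow_sub_pow _ _ (p ^ n))).mul_left (G ^ 2)
      convert this using 1
      simp
      ring
  · intro a ha hθ
    have ht0 := hθ 0
    have ht1 := hθ 1
    have ht2 := hθ 2
    have ht3 := hθ 3
    simp only [Matrix.cons_val_zero, Matrix.cons_val_one, Matrix.cons_val, map_pow]
      at ht0 ht1 ht2 ht3
    have ht0 := eq_zero_of_pow_eq_zero ht0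
    have ht1 := eq_zero_of_pow_eq_zero ht1
    have ht2 := eq_zero_of_pow_eq_zero ht2
    have ht3 := eq_zero_of_pow_eq_zero ht3
    rw [hN, eval_linearForm] at ht0
    obtain ⟨s, t, rfl⟩ := exists_eq_smul_add_smul he0 hA he1 hB ht0
    rw [hfst] at ha
    have hcontra : ∀ (P : Fin 3 → k) (g : MvPolynomial (Fin 3) k) (d : ℕ) (u : k),
        g.IsHomogeneous d → eval P g ≠ 0 → eval (u • P) g = 0 → u • P = 0 := by
      intro P g d u hg hP h
      rw [eval_smul_of_isHomogeneous hg] at h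
      rw [eq_zero_of_pow_eq_zero ((mul_eq_zero.1 h).resolve_right hP), zero_smul]
    rcases mul_eq_zero.1 ha with h | h
    · rcases mul_eq_zero.1 h with rfl | rfl
      · rw [zero_smul, zero_add] at ht2 ⊢
        exact hcontra _ _ _ _ hs₁ hsP₁ ht2
      · rw [zero_smul, add_zero] at ht1 ⊢
        exact hcontra _ _ _ _ hs₀ hsP₀ ht1
    · have hst : s • P₀ + t • P₁ = (s / B) • P₂ := by
        rw [hP2def, smul_add, smul_smul, smul_smul, div_mul_cancel₀ _ hB]
        congr 2
        field_simp
        linear_combination h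
      rw [hst] at ht3 ⊢
      exact hcontra _ _ _ _ hs₂ hsP₂ ht3

end Vanishing

section Cross

lemma dvd_mul_cross_sub_mul_cross {R : Type*} [CommRing R] {d : R} {v x c : Fin 3 → R}
    (hx : d ∣ ∑ l, v l * x l) (hc : d ∣ ∑ l, v l * c l) (a b : Fin 3) :
    d ∣ v a * crossProduct x c b - v b * crossProduct x c a := by
  have h : ∀ i, d ∣ crossProduct v (crossProduct x c) i := by
    intro i
    rw [cross_cross_eq_smul_sub_smul', dotProduct_comm x]
    exact dvd_sub (Dvd.dvd.mul_right hc _) (Dvd.dvd.mul_right hx _)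
  have h0 := h 0
  have h1 := h 1
  have h2 := h 2
  rw [cross_apply v] at h0 h1 h2
  simp only [Matrix.cons_val_zero, Matrix.cons_val_one, Matrix.cons_val] at h0 h1 h2
  generalize crossProduct x c = y at *
  fin_cases a <;> fin_cases b <;> simp only [Fin.zero_eta, Fin.mk_one, Fin.reduceFinMk, sub_self,
    dvd_zero] <;> first | assumption | (rw [dvd_sub_comm]; assumption)

variable {k : Type*} [Field k] {p : ℕ} [ExpChar k p]

lemma linearForm_cross_pow (n : ℕ) (ω : Fin 3 → k) (b : Fin 3) :
    linearForm (crossProduct ω (Pi.single b 1)) ^ p ^ n =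
      crossProduct (fun l => X l ^ p ^ n) (fun l => C (ω l ^ p ^ n)) b := by
  have h : ∀ s t, (X s * C (ω t) : MvPolynomial (Fin 3) k) ^ p ^ n =
      X s ^ p ^ n * C (ω t ^ p ^ n) := by
    intro s t
    rw [mul_pow, ← C_pow]
  have h2 : linearForm (crossProduct ω (Pi.single b 1)) =
      crossProduct X (fun l => C (ω l)) b := by
    fin_cases b <;> simp [linearForm, cross_apply, Fin.sum_univ_three] <;> ring
  rw [h2]
  fin_cases b <;> simp only [cross_apply, ← h]
  · exact sub_pow_expChar_pow _ _ _
  · exact sub_pow_expChar_pow _ _ _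
  · exact sub_pow_expChar_pow _ _ _

end Cross

section Vanishing

variable {k : Type*} [Field k] [IsAlgClosed k] {f : MvPolynomial (Fin 3) k}
  {p : ℕ} [ExpChar k p]

/-- On a smooth cubic there is no nontrivial relation between the `q`-th powers of the variables
whose coefficients have degree less than `q / 2`. -/
theorem dvd_of_dvd_sum_mul_X_pow (hf : f.IsHomogeneous 3)
    (hsmooth : ∀ a : Fin 3 → k, eval a f = 0 → (∀ i, eval a (pderiv i f) = 0) → a = 0)
    {n e : ℕ} (he : 2 * e < p ^ n) {v : Fin 3 → MvPolynomial (Fin 3) k}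
    (hv : ∀ l, (v l).IsHomogeneous e) (hfv : f ∣ ∑ l, v l * X l ^ p ^ n) (l : Fin 3) :
    f ∣ v l := by
  by_contra hvl
  have hprime := prime_of_smooth hf hsmooth
  have hf0 := hprime.ne_zero
  have hpos : 0 < p ^ n := by omega
  obtain ⟨c, hc0, hfc⟩ := exists_linear_relation hf hsmooth he hv hfv hvl
  choose ω hω using fun l => IsAlgClosed.exists_pow_nat_eq (c l) hpos
  have hω0 : ω ≠ 0 := by
    rintro rfl
    exact hc0 (funext fun l => by rw [← hω, Pi.zero_apply, zero_pow hpos.ne'])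
  set L : Fin 3 → MvPolynomial (Fin 3) k :=
    fun b => linearForm (crossProduct ω (Pi.single b 1)) with hL
  have hLq : ∀ b, L b ^ p ^ n = crossProduct (fun l => X l ^ p ^ n) (fun l => C (c l)) b := by
    intro b
    simp only [hL, linearForm_cross_pow n, hω]
  have hLeval : ∀ a b, eval a (L b) = crossProduct a ω b := fun a b => by
    rw [hL, eval_linearForm, dotProduct_comm, triple_product_permutation,
      triple_product_permutation, single_one_dotProduct]
  have hcompat : ∀ a b, f ∣ v a * L b ^ p ^ n - v b * L a ^ p ^ n := by
    intro a b
    rw [hLq, hLq]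
    refine dvd_mul_cross_sub_mul_cross hfv ?_ a b
    simpa only [mul_comm] using hfc
  have hdvd : ∀ b, f ∣ v b := by
    have hL1 : ∀ b, (L b).IsHomogeneous 1 := fun b => isHomogeneous_linearForm _
    have hLf : ∀ b, L b ≠ 0 → ¬ f ∣ L b := fun b hb =>
      not_dvd_of_isHomogeneous_lt hf hf0 (hL1 b) hb (by norm_num)
    have hzero : ∀ a, (∀ b, eval a (L b) = 0) → ∃ t : k, a = t • ω := fun a ha =>
      exists_eq_smul_of_cross_eq_zero hω0 (funext fun b => by rw [← hLeval, ha, Pi.zero_apply])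
    by_cases hfω : eval ω f = 0
    · obtain ⟨b₀, hb₀⟩ := Function.ne_iff.1 (gradAt_ne_zero hsmooth hω0 hfω)
      have hcross : crossProduct (gradAt f ω) (crossProduct ω (Pi.single b₀ 1)) ≠ 0 := by
        rw [cross_cross_eq_smul_sub_smul', dotProduct_comm ω, gradAt_dotProduct_self hf hfω,
          zero_smul, sub_zero, dotProduct_single, mul_one]
        exact smul_ne_zero hb₀ hω0
      obtain ⟨s, D, ⟨d, hs⟩, hsω, hd⟩ := exists_dvd_mul_tangent_sub hf hsmooth hω0 hfω
        (by rw [dotProduct_comm, dot_self_cross]) hcross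
      change f ∣ s * _ - D * L b₀ ^ 2 at hd
      have hLb : ¬ f ∣ L b₀ := by
        refine hLf _ (linearForm_ne_zero fun h => hcross ?_)
        rw [h, map_zero]
      set T := linearForm (gradAt f ω) with hT
      have hT0 : ¬ f ∣ T := not_dvd_of_isHomogeneous_lt hf hf0 (isHomogeneous_linearForm _)
        (linearForm_ne_zero (gradAt_ne_zero hsmooth hω0 hfω)) (by norm_num)
      intro b
      have key := dvd_of_compatible_fractions hprime hf
        (fun t : Option (Fin 3) => t.elim (s ^ p ^ n) fun b => L b ^ (2 * p ^ n))
        (fun t : Option (Fin 3) => t.elim (v b₀ ^ 2 * D ^ p ^ n) fun b => v b ^ 2 * T ^ p ^ n)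
        (some b₀) (d := 1 * (2 * p ^ n)) ((hL1 _).pow _) ?_
        (fun h => hLb (hprime.dvd_of_dvd_pow h)) ?_ ?_ (some b)
      · rcases hprime.dvd_or_dvd key with h | h
        · exact hprime.dvd_of_dvd_pow h
        · exact absurd (hprime.dvd_of_dvd_pow h) hT0
      · have e1 := totalDegree_mul (v b₀ ^ 2) (T ^ p ^ n)
        have e2 := totalDegree_pow (v b₀) 2
        have e3 := totalDegree_pow T (p ^ n)
        have e4 : p ^ n * T.totalDegree ≤ p ^ n * 1 :=
          Nat.mul_le_mul_left _ (isHomogeneous_linearForm _).totalDegree_le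
        have e5 := (hv b₀).totalDegree_le
        simp only [Option.elim]
        omega
      · rintro (_ | b)
        · have := (hd.trans (sub_dvd_pow_sub_pow _ _ (p ^ n))).mul_left (v b₀ ^ 2)
          convert this using 1
          simp only [Option.elim]
          ring
        · convert (hcompat b₀ b).mul_right
            ((v b₀ * L b ^ p ^ n + v b * L b₀ ^ p ^ n) * T ^ p ^ n) using 1
          simp only [Option.elim]
          ring
      · intro a _ hθ
        obtain ⟨t, rfl⟩ := hzero a fun b => by
          have := hθ (some b)
          simp only [Option.elim, map_pow] at this
          exact eq_zero_of_pow_eq_zero this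
        have := hθ none
        simp only [Option.elim, map_pow] at this
        have := eq_zero_of_pow_eq_zero this
        rw [eval_smul_of_isHomogeneous hs] at this
        rw [eq_zero_of_pow_eq_zero ((mul_eq_zero.1 this).resolve_right hsω), zero_smul]
    · obtain ⟨b₀, hb₀⟩ : ∃ b, L b ≠ 0 := by
        by_contra! h
        obtain ⟨t, ht⟩ := hzero (fun _ => 1) fun b => by rw [h, map_zero]
        obtain ⟨t', ht'⟩ := hzero (Pi.single 0 1) fun b => by rw [h, map_zero]
        have e0 := congrFun ht 0
        have e1 := congrFun ht 1
        have e2 := congrFun ht' 0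
        have e3 := congrFun ht' 1
        simp only [Pi.smul_apply, smul_eq_mul, Pi.single_eq_same,
          Pi.single_eq_of_ne one_ne_zero] at e0 e1 e2 e3
        rcases mul_eq_zero.1 e3.symm with h | h <;> simp [h] at e1 e2
      refine dvd_of_compatible_fractions hprime hf (fun b => L b ^ p ^ n) v b₀ (d := 1 * p ^ n)
        ((hL1 _).pow _) ?_ (fun h => hLf b₀ hb₀ (hprime.dvd_of_dvd_pow h)) ?_ ?_
      · have := (hv b₀).totalDegree_le
        omega
      · intro t
        convert hcompat b₀ t using 1
        ring
      · intro a ha hθ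
        obtain ⟨t, rfl⟩ := hzero a fun b => by
          have := hθ b
          rw [map_pow] at this
          exact eq_zero_of_pow_eq_zero this
        rw [eval_smul_of_isHomogeneous hf] at ha
        rw [eq_zero_of_pow_eq_zero ((mul_eq_zero.1 ha).resolve_right hfω), zero_smul]
  exact hvl (hdvd l)

end Vanishing

section Injectivity

variable {k : Type*} [Field k]

lemma mem_span_range_X_pow_iff {σ : Type*} {q : ℕ} {g : MvPolynomial σ k} :
    g ∈ Ideal.span (Set.range fun i => (X i : MvPolynomial σ k) ^ q) ↔
      ∀ m : σ →₀ ℕ, (∀ i, m i < q) → coeff m g = 0 := by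
  rw [← Set.image_univ, mem_span_X_pow_iff]
  refine forall_congr' fun m => ?_
  rw [mem_support_iff]
  constructor
  · intro h hm
    by_contra h0
    obtain ⟨i, -, hi⟩ := h h0
    exact absurd (hm i) (by omega)
  · intro h h0
    by_contra! hcon
    exact h0 (h fun i => hcon i (Set.mem_univ i))

lemma coeff_eq_zero_of_mul_mem_span_X_pow [IsAlgClosed k] {f : MvPolynomial (Fin 3) k} {p : ℕ}
    [ExpChar k p] (hf : f.IsHomogeneous 3)
    (hsmooth : ∀ a : Fin 3 → k, eval a f = 0 → (∀ i, eval a (pderiv i f) = 0) → a = 0)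
    {n D : ℕ} (hD : 2 * D < 3 * p ^ n) {g : MvPolynomial (Fin 3) k}
    (hg : f * g ∈ Ideal.span (Set.range fun i => (X i : MvPolynomial (Fin 3) k) ^ p ^ n))
    {a : Fin 3 →₀ ℕ} (ha : ∀ i, a i < p ^ n) (had : a.degree + 3 ≤ D) : coeff a g = 0 := by
  have hf0 := (prime_of_smooth hf hsmooth).ne_zero
  have hX : ∀ l, ((X l : MvPolynomial (Fin 3) k) ^ p ^ n).IsHomogeneous (p ^ n) := fun l => by
    simpa using (isHomogeneous_X k l).pow (p ^ n)
  obtain ⟨c, hc⟩ := Ideal.mem_span_range_iff_exists_fun.1 hg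
  have hG := homogeneousComponent_add_mul_of_isHomogeneous hf a.degree g
  rw [← hc, map_sum] at hG
  have hcoeff : coeff a g = coeff a (homogeneousComponent a.degree g) := by
    rw [coeff_homogeneousComponent, if_pos rfl]
  rw [hcoeff]
  rcases lt_or_ge (3 + a.degree) (p ^ n) with hlt | hle
  · rw [Finset.sum_eq_zero fun l _ => by
      rw [mul_comm, homogeneousComponent_mul_of_lt (hX l) hlt], eq_comm] at hG
    rw [(mul_eq_zero.1 hG).resolve_left hf0, coeff_zero]
  · obtain ⟨e, he⟩ := Nat.exists_eq_add_of_le hle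
    simp_rw [he, mul_comm (c _), homogeneousComponent_add_mul_of_isHomogeneous (hX _)] at hG
    choose u hu using dvd_of_dvd_sum_mul_X_pow (p := p) hf hsmooth (n := n) (e := e) (by omega)
      (v := fun l => homogeneousComponent e (c l))
      (fun l => homogeneousComponent_isHomogeneous e _)
      ⟨homogeneousComponent a.degree g, by
        rw [← hG]
        exact Finset.sum_congr rfl fun l _ => mul_comm _ _⟩
    refine mem_span_range_X_pow_iff.1 (Ideal.mem_span_range_iff_exists_fun.2 ⟨u, ?_⟩) a ha
    apply mul_left_cancel₀ hf0
    rw [← hG, Finset.mul_sum]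
    exact Finset.sum_congr rfl fun l _ => by rw [hu l]; ring

end Injectivity

section Truncation

variable {k : Type*} [Field k] {σ : Type*}

open Classical in
/-- The part of a polynomial supported on the exponents in `B`. -/
noncomputable def truncateTo (B : Set (σ →₀ ℕ)) :
    MvPolynomial σ k →ₗ[k] MvPolynomial σ k :=
  (basisMonomials σ k).constr k fun m => if m ∈ B then monomial m 1 else 0

open Classical in
lemma coeff_truncateTo (B : Set (σ →₀ ℕ)) (g : MvPolynomial σ k) (m : σ →₀ ℕ) :
    coeff m (truncateTo B g) = if m ∈ B then coeff m g else 0 := by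
  induction g using MvPolynomial.induction_on' with
  | monomial u a =>
    have h : monomial u a = a • basisMonomials σ k u := by simp [smul_monomial]
    rw [h, map_smul, truncateTo, Module.Basis.constr_basis, coeff_smul, coeff_smul]
    by_cases hum : u = m
    · subst hum
      split_ifs <;> simp
    · split_ifs <;> simp [hum]
  | add g h hg hh =>
    rw [map_add, coeff_add, hg, hh, coeff_add]
    split_ifs <;> simp

lemma truncateTo_mem (B : Set (σ →₀ ℕ)) (g : MvPolynomial σ k) :
    truncateTo B g ∈ restrictSupport k B := by
  classical
  rw [mem_restrictSupport_iff]
  intro m hm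
  rw [Finset.mem_coe, mem_support_iff, coeff_truncateTo] at hm
  by_contra h
  exact hm (if_neg h)

lemma coeff_eq_zero_of_mem_restrictSupport {B : Set (σ →₀ ℕ)} {g : MvPolynomial σ k}
    (hg : g ∈ restrictSupport k B) {m : σ →₀ ℕ} (hm : m ∉ B) : coeff m g = 0 := by
  rw [mem_restrictSupport_iff] at hg
  by_contra h
  exact hm (hg (mem_support_iff.2 h))

lemma finrank_restrictSupport (B : Set (σ →₀ ℕ)) :
    Module.finrank k (restrictSupport k B) = B.ncard :=
  Module.finrank_eq_nat_card_basis (basisRestrictSupport k B)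

/-- Exponents in the box `[0, q)` whose degree is at most `D - c`. -/
def boxTruncation (q D c : ℕ) : Set (Fin 3 →₀ ℕ) :=
  {m | (∀ i, m i < q) ∧ m.degree + c ≤ D}

lemma finite_boxTruncation (q D c : ℕ) : (boxTruncation q D c).Finite := by
  refine (Set.finite_Iic (Finsupp.equivFunOnFinite.symm fun _ : Fin 3 => q)).subset ?_
  intro m hm i
  exact (hm.1 i).le

end Truncation

section Counting

variable {k : Type*} [Field k] {f : MvPolynomial (Fin 3) k} {q D : ℕ}

lemma mul_sub_truncateTo_mem (hf : f.IsHomogeneous 3) {g : MvPolynomial (Fin 3) k}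
    (hg : g ∈ restrictSupport k (boxTruncation q D 3)) :
    f * g - truncateTo (boxTruncation q D 0) (f * g) ∈
      Ideal.span (Set.range fun i => (X i : MvPolynomial (Fin 3) k) ^ q) := by
  classical
  rw [mem_span_range_X_pow_iff]
  intro m hm
  rw [coeff_sub, coeff_truncateTo]
  split_ifs with h
  · exact sub_self _
  · rw [sub_zero, coeff_mul]
    refine Finset.sum_eq_zero fun x hx => ?_
    rw [Finset.HasAntidiagonal.mem_antidiagonal] at hx
    by_cases hx3 : x.1.degree = 3
    · rw [coeff_eq_zero_of_mem_restrictSupport hg, mul_zero]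
      intro hx2
      have hdeg := congrArg Finsupp.degree hx
      rw [map_add] at hdeg
      have := hx2.2
      exact h ⟨hm, by omega⟩
    · rw [hf.coeff_eq_zero hx3, zero_mul]

lemma truncateTo_mul_truncateTo (hf : f.IsHomogeneous 3) (g : MvPolynomial (Fin 3) k) :
    truncateTo (boxTruncation q D 0) (f * truncateTo (boxTruncation q D 3) g) =
      truncateTo (boxTruncation q D 0) (f * g) := by
  classical
  ext m
  rw [coeff_truncateTo, coeff_truncateTo]
  refine ite_congr rfl (fun hm => ?_) fun _ => rfl
  rw [coeff_mul, coeff_mul]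
  refine Finset.sum_congr rfl fun x hx => ?_
  rw [Finset.HasAntidiagonal.mem_antidiagonal] at hx
  by_cases hx3 : x.1.degree = 3
  · rw [coeff_truncateTo, if_pos]
    have hdeg := congrArg Finsupp.degree hx
    rw [map_add] at hdeg
    have := hm.2
    refine ⟨fun i => lt_of_le_of_lt ?_ (hm.1 i), by omega⟩
    rw [← hx]
    exact Nat.le_add_left _ _
  · rw [hf.coeff_eq_zero hx3, zero_mul, zero_mul]

lemma truncateTo_eq_zero_of_mem {g : MvPolynomial (Fin 3) k}
    (hg : g ∈ Ideal.span (Set.range fun i => (X i : MvPolynomial (Fin 3) k) ^ q)) (c : ℕ) :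
    truncateTo (boxTruncation q D c) g = 0 := by
  ext m
  rw [coeff_truncateTo, coeff_zero]
  split_ifs with h
  · exact mem_span_range_X_pow_iff.1 hg m h.1
  · rfl

lemma truncateTo_of_mem {B : Set (Fin 3 →₀ ℕ)} {g : MvPolynomial (Fin 3) k}
    (hg : g ∈ restrictSupport k B) : truncateTo B g = g := by
  ext m
  rw [coeff_truncateTo]
  split_ifs with h
  · rfl
  · exact (coeff_eq_zero_of_mem_restrictSupport hg h).symm

lemma exists_mul_mem_of_functional {L : MvPolynomial (Fin 3) k →ₗ[k] k}
    (hLf : ∀ g, L (f * g) = 0)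
    (hLI : ∀ g ∈ Ideal.span (Set.range fun i => (X i : MvPolynomial (Fin 3) k) ^ q), L g = 0)
    {top : Fin 3 →₀ ℕ} (htop : ∀ i, top i + 1 = q) :
    ∃ h, f * h ∈ Ideal.span (Set.range fun i => (X i : MvPolynomial (Fin 3) k) ^ q) ∧
      ∀ a ≤ top, coeff a h = L (monomial (top - a) 1) := by
  classical
  have hcoeff : ∀ a ≤ top, coeff a (∑ b ∈ Finset.Iic top,
      monomial b (L (monomial (top - b) 1))) = L (monomial (top - a) 1) := by
    intro a ha
    simp [coeff_sum, coeff_monomial, ha]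
  refine ⟨_, ?_, hcoeff⟩
  generalize ∑ b ∈ Finset.Iic top, monomial b (L (monomial (top - b) 1)) = h at hcoeff
  rw [mem_span_range_X_pow_iff]
  intro c hc
  have hct : c ≤ top := fun i => by
    have := hc i
    have := htop i
    omega
  rw [← hLf (monomial (top - c) 1), f.as_sum, Finset.sum_mul, Finset.sum_mul, map_sum, coeff_sum]
  refine Finset.sum_congr rfl fun x _ => ?_
  rw [coeff_monomial_mul', monomial_mul, mul_one]
  split_ifs with hx
  · have he : top - (c - x) = x + (top - c) := by
      ext i
      have := hx i
      have := hct i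
      simp only [Finsupp.tsub_apply, Finsupp.add_apply]
      omega
    rw [hcoeff _ (tsub_le_self.trans hct), he, ← smul_eq_mul, ← map_smul, smul_monomial,
      smul_eq_mul, mul_one]
  · symm
    apply hLI
    rw [mem_span_range_X_pow_iff]
    intro m hm
    rw [coeff_monomial, if_neg]
    rintro rfl
    refine hx fun i => ?_
    have := hm i
    have := htop i
    have := hct i
    simp only [Finsupp.tsub_apply, Finsupp.add_apply] at *
    omega

lemma sup_restrictSupport_eq_top (hq : 0 < q) (hD : 3 * q ≤ 2 * D + 1)
    (hinj : ∀ g, f * g ∈ Ideal.span (Set.range fun i => (X i : MvPolynomial (Fin 3) k) ^ q) →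
      ∀ a ∈ boxTruncation q D 3, coeff a g = 0) :
    (Ideal.span {f} ⊔ Ideal.span (Set.range fun i =>
      (X i : MvPolynomial (Fin 3) k) ^ q)).restrictScalars k ⊔
      restrictSupport k (boxTruncation q D 0) = ⊤ := by
  by_contra hne
  obtain ⟨L, hL0, hL⟩ := Submodule.exists_le_ker_of_lt_top _ (lt_top_iff_ne_top.2 hne)
  have hLf : ∀ g, L (f * g) = 0 := fun g =>
    hL (Submodule.mem_sup_left (Ideal.mem_sup_left
      (Ideal.mem_span_singleton.2 (Dvd.intro _ rfl))))
  have hLI : ∀ g ∈ Ideal.span (Set.range fun i => (X i : MvPolynomial (Fin 3) k) ^ q),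
      L g = 0 := fun g hg =>
    hL (Submodule.mem_sup_left (Ideal.mem_sup_right hg))
  set top : Fin 3 →₀ ℕ := Finsupp.equivFunOnFinite.symm fun _ => q - 1 with htop
  have htop' : ∀ i, top i = q - 1 := fun i => rfl
  obtain ⟨h, hfh, hh⟩ := exists_mul_mem_of_functional hLf hLI (top := top) fun i => by
    rw [htop']
    omega
  apply hL0
  refine (basisMonomials (Fin 3) k).ext fun m => ?_
  rw [coe_basisMonomials, LinearMap.zero_apply]
  by_cases hm : ∀ i, m i < q
  · rcases le_or_gt m.degree D with hd | hd
    · refine hL (Submodule.mem_sup_right ?_)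
      rw [mem_restrictSupport_iff]
      intro x hx
      rw [Finset.mem_singleton.1 (support_monomial_subset hx)]
      exact ⟨hm, hd⟩
    · have hmt : m ≤ top := fun i => by
        have := hm i
        rw [htop']
        omega
      rw [← tsub_tsub_cancel_of_le hmt, ← hh _ tsub_le_self]
      refine hinj h hfh _ ⟨fun i => ?_, ?_⟩
      · rw [Finsupp.tsub_apply, htop']
        omega
      · have h0 := hm 0
        have h1 := hm 1
        have h2 := hm 2
        rw [Finsupp.degree_eq_sum, Fin.sum_univ_three] at hd ⊢
        simp only [Finsupp.tsub_apply, htop']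
        omega
  · refine hLI _ (mem_span_range_X_pow_iff.2 fun c hc => ?_)
    rw [coeff_monomial, if_neg]
    rintro rfl
    exact hm hc

/-- If multiplication by a cubic `f` modulo the `q`-th powers of the variables is injective in
low degrees, then the length of the quotient by `f` and the `q`-th powers is the one predicted by
counting monomials. -/
theorem finrank_quotient_add_ncard (hf : f.IsHomogeneous 3) (hq : 0 < q)
    (hD : 3 * q ≤ 2 * D + 1)
    (hinj : ∀ g, f * g ∈ Ideal.span (Set.range fun i => (X i : MvPolynomial (Fin 3) k) ^ q) →
      ∀ a ∈ boxTruncation q D 3, coeff a g = 0) :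
    Module.finrank k (MvPolynomial (Fin 3) k ⧸ (Ideal.span {f} ⊔ Ideal.span (Set.range fun i =>
      (X i : MvPolynomial (Fin 3) k) ^ q))) + (boxTruncation q D 3).ncard =
      (boxTruncation q D 0).ncard := by
  set J := Ideal.span {f} ⊔ Ideal.span (Set.range fun i => (X i : MvPolynomial (Fin 3) k) ^ q)
    with hJ
  set W := restrictSupport k (boxTruncation q D 0)
  set Ψ : W →ₗ[k] MvPolynomial (Fin 3) k ⧸ J :=
    (Ideal.Quotient.mkₐ k J).toLinearMap ∘ₗ W.subtype with hΨ
  have hΨ_apply : ∀ w, Ψ w = Ideal.Quotient.mk J w := fun w => rfl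
  set φ : restrictSupport k (boxTruncation q D 3) →ₗ[k] W :=
    LinearMap.codRestrict W (truncateTo (boxTruncation q D 0) ∘ₗ LinearMap.mulLeft k f ∘ₗ
      (restrictSupport k (boxTruncation q D 3)).subtype) fun g => truncateTo_mem _ _
  have hφ_apply : ∀ g, (φ g : MvPolynomial (Fin 3) k) =
      truncateTo (boxTruncation q D 0) (f * (g : MvPolynomial (Fin 3) k)) := fun g => rfl
  have hφ : Function.Injective φ := by
    rw [← LinearMap.ker_eq_bot, LinearMap.ker_eq_bot']
    intro g hg
    have h := mul_sub_truncateTo_mem (q := q) (D := D) hf g.2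
    rw [← hφ_apply, hg, ZeroMemClass.coe_zero, sub_zero] at h
    ext m
    by_cases hm : m ∈ boxTruncation q D 3
    · exact hinj _ h m hm
    · exact coeff_eq_zero_of_mem_restrictSupport g.2 hm
  have hsurj : LinearMap.range Ψ = ⊤ := by
    rw [LinearMap.range_eq_top]
    intro y
    obtain ⟨g, rfl⟩ := Ideal.Quotient.mk_surjective y
    have hg : g ∈ J.restrictScalars k ⊔ W := by
      rw [sup_restrictSupport_eq_top hq hD hinj]
      trivial
    obtain ⟨a, ha, w, hw, rfl⟩ := Submodule.mem_sup.1 hg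
    refine ⟨⟨w, hw⟩, ?_⟩
    have ha0 : Ideal.Quotient.mk J a = 0 := Ideal.Quotient.eq_zero_iff_mem.2 ha
    rw [hΨ_apply, map_add, ha0, zero_add]
  have hker : LinearMap.ker Ψ = LinearMap.range φ := by
    ext w
    rw [LinearMap.mem_ker, hΨ_apply, Ideal.Quotient.eq_zero_iff_mem]
    constructor
    · intro hw
      obtain ⟨b, hb, a, ha, hab⟩ := Submodule.mem_sup.1 hw
      obtain ⟨g, rfl⟩ := Ideal.mem_span_singleton.1 hb
      refine ⟨⟨truncateTo (boxTruncation q D 3) g, truncateTo_mem _ _⟩, Subtype.ext ?_⟩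
      rw [hφ_apply, truncateTo_mul_truncateTo hf, ← truncateTo_of_mem w.2, ← hab, map_add,
        truncateTo_eq_zero_of_mem ha, add_zero]
    · rintro ⟨g, rfl⟩
      rw [hφ_apply, ← sub_sub_self (f * (g : MvPolynomial (Fin 3) k))
        (truncateTo (boxTruncation q D 0) (f * g))]
      exact sub_mem (Ideal.mem_sup_left (Ideal.mem_span_singleton.2 (Dvd.intro _ rfl)))
        (Ideal.mem_sup_right (mul_sub_truncateTo_mem hf g.2))
  have : Finite (boxTruncation q D 0) := finite_boxTruncation q D 0
  have : FiniteDimensional k W :=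
    (basisRestrictSupport k (boxTruncation q D 0)).finiteDimensional_of_finite
  have hrank := LinearMap.finrank_range_add_finrank_ker Ψ
  rw [hsurj, finrank_top, hker, LinearMap.finrank_range_of_inj hφ] at hrank
  rwa [finrank_restrictSupport, finrank_restrictSupport] at hrank

end Counting

section LatticePoints

lemma sum_range_card_slab (r t : ℕ) :
    ∑ s ∈ Finset.range t, (min (2 * r + 1) (3 * r + 2 - s) - (3 * r - 1 - s)) =
      (min t (3 * r) - (r - 1)) + (min t (3 * r + 1) - r) + (min t (3 * r + 2) - (r + 1)) := by
  induction t with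
  | zero => simp
  | succ t ih =>
    rw [Finset.sum_range_succ, ih]
    omega

lemma card_slab (r : ℕ) :
    ∑ a ∈ Finset.range (2 * r + 1), ∑ b ∈ Finset.range (2 * r + 1),
      (min (2 * r + 1) (3 * r + 2 - (a + b)) - (3 * r - 1 - (a + b))) =
      9 * r ^ 2 + 9 * r + 1 := by
  set P : ℕ → ℕ := fun t =>
    (min t (3 * r) - (r - 1)) + (min t (3 * r + 1) - r) + (min t (3 * r + 2) - (r + 1)) with hP
  have h : ∀ a, ∑ b ∈ Finset.range (2 * r + 1),
      (min (2 * r + 1) (3 * r + 2 - (a + b)) - (3 * r - 1 - (a + b))) =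
      P (a + (2 * r + 1)) - P a := by
    intro a
    have h1 := sum_range_card_slab r (a + (2 * r + 1))
    rw [Finset.sum_range_add, sum_range_card_slab r a] at h1
    exact Nat.eq_sub_of_add_eq' h1
  simp_rw [h]
  have hlow : ∀ t < r, P t = 0 := by
    intro t ht
    simp only [hP]
    omega
  have hmid : ∀ t, r < t → t ≤ 3 * r → P t = 3 * (t - r) := by
    intro t ht ht'
    simp only [hP]
    omega
  have hhigh : ∀ t, 0 < r → 3 * r + 1 < t → P t = 6 * r + 3 := by
    intro t hr ht
    simp only [hP]
    omega
  have h1 : ∀ i ∈ Finset.range r, P (i + (2 * r + 1)) - P i +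
      (P (r + 1 + i + (2 * r + 1)) - P (r + 1 + i)) = 9 * r + 3 := by
    intro i hi
    have := Finset.mem_range.1 hi
    rw [hlow i this, hmid (i + (2 * r + 1)) (by omega) (by omega),
      hmid (r + 1 + i) (by omega) (by omega), hhigh _ (by omega) (by omega)]
    omega
  have h2 : P (r + (2 * r + 1)) - P r = 6 * r + 1 := by
    rcases Nat.eq_zero_or_pos r with rfl | hr
    · simp [hP]
    · have e1 : P r = 1 := by
        simp only [hP]
        omega
      have e2 : P (r + (2 * r + 1)) = 6 * r + 2 := by
        simp only [hP]
        omega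
      omega
  have h3 : Finset.range (2 * r + 1) = Finset.range (r + 1 + r) := by
    congr 1
    ring
  rw [h3, Finset.sum_range_add, Finset.sum_range_succ,
    add_right_comm, ← Finset.sum_add_distrib, Finset.sum_congr rfl h1, h2, Finset.sum_const,
    Finset.card_range, smul_eq_mul]
  ring

lemma ncard_boxTruncation (r : ℕ) :
    (boxTruncation (2 * r + 1) (3 * r + 1) 0).ncard =
      9 * r ^ 2 + 9 * r + 1 + (boxTruncation (2 * r + 1) (3 * r + 1) 3).ncard := by
  have hsub : boxTruncation (2 * r + 1) (3 * r + 1) 3 ⊆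
      boxTruncation (2 * r + 1) (3 * r + 1) 0 := by
    rintro m ⟨h1, h2⟩
    exact ⟨h1, by omega⟩
  rw [← Set.ncard_sdiff_add_ncard_of_subset hsub (finite_boxTruncation _ _ _), ← card_slab r]
  congr 1
  set F : Finset (Σ _ : ℕ, Σ _ : ℕ, ℕ) :=
    (Finset.range (2 * r + 1)).sigma fun a => (Finset.range (2 * r + 1)).sigma fun b =>
      Finset.Ico (3 * r - 1 - (a + b)) (min (2 * r + 1) (3 * r + 2 - (a + b))) with hF
  have hcard : F.card = ∑ a ∈ Finset.range (2 * r + 1), ∑ b ∈ Finset.range (2 * r + 1),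
      (min (2 * r + 1) (3 * r + 2 - (a + b)) - (3 * r - 1 - (a + b))) := by
    simp [hF, Finset.card_sigma]
  rw [← hcard, ← Set.ncard_coe_finset]
  refine Set.ncard_congr (fun m _ => ⟨m 0, m 1, m 2⟩) ?_ ?_ ?_
  · rintro m ⟨⟨hm, hd⟩, hd3⟩
    have hd3' : ¬ m.degree + 3 ≤ 3 * r + 1 := fun h => hd3 ⟨hm, h⟩
    have h0 := hm 0
    have h1 := hm 1
    have h2 := hm 2
    rw [Finsupp.degree_eq_sum, Fin.sum_univ_three] at hd hd3'
    simp only [hF, Finset.mem_coe, Finset.mem_sigma, Finset.mem_range, Finset.mem_Ico]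
    omega
  · intro m m' _ _ h
    simp only [Sigma.mk.injEq, heq_eq_eq] at h
    ext i
    fin_cases i
    · exact h.1
    · exact h.2.1
    · exact h.2.2
  · rintro ⟨a, b, c⟩ h
    simp only [hF, Finset.mem_coe, Finset.mem_sigma, Finset.mem_range, Finset.mem_Ico] at h
    have hdeg : (Finsupp.equivFunOnFinite.symm ![a, b, c]).degree = a + b + c := by
      rw [Finsupp.degree_eq_sum, Fin.sum_univ_three]
      rfl
    refine ⟨Finsupp.equivFunOnFinite.symm ![a, b, c], ⟨⟨?_, ?_⟩, fun h3 => ?_⟩, rfl⟩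
    · intro i
      fin_cases i
      · exact h.1
      · exact h.2.1
      · exact h.2.2.2.trans_le (min_le_left _ _)
    · omega
    · have := h3.2
      omega

end LatticePoints

/-- **Hilbert-Kunz function of plane elliptic curves in odd characteristic.**
If `f ∈ k[x,y,z]` is a homogeneous cubic over an algebraically closed field of odd
characteristic `p` such that `f` and its partial derivatives have no common zero other
than the origin, then for every `q = p^n`,
`dim_k k[x,y,z]/(f, x^q, y^q, z^q) = (9q² − 5)/4`. -/
theorem hilbert_kunz_elliptic_curve_odd_char
    (k : Type*) [Field k] [IsAlgClosed k] (p : ℕ) [Fact p.Prime] [CharP k p]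
    (hodd : Odd p)
    (f : MvPolynomial (Fin 3) k) (hf : f.IsHomogeneous 3)
    (hsmooth : ∀ a : Fin 3 → k,
      eval a f = 0 → (∀ i : Fin 3, eval a (pderiv i f) = 0) → a = 0)
    (n : ℕ) :
    4 * Module.finrank k (MvPolynomial (Fin 3) k ⧸
        Ideal.span {f, X 0 ^ p ^ n, X 1 ^ p ^ n, X 2 ^ p ^ n}) =
      9 * (p ^ n) ^ 2 - 5 := by
  have : ExpChar k p := ExpChar.prime Fact.out
  obtain ⟨r, hr⟩ := hodd.pow (n := n)
  have hspan : Ideal.span {f, X 0 ^ p ^ n, X 1 ^ p ^ n, X 2 ^ p ^ n} = Ideal.span {f} ⊔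
      Ideal.span (Set.range fun i => (X i : MvPolynomial (Fin 3) k) ^ p ^ n) := by
    rw [← Ideal.span_union, Set.singleton_union]
    congr 2
    ext g
    simp [Fin.exists_fin_succ, eq_comm]
  have hcount := finrank_quotient_add_ncard (q := p ^ n) (D := 3 * r + 1) hf (by omega) (by omega)
    fun g hg a ha => coeff_eq_zero_of_mul_mem_span_X_pow hf hsmooth (by omega) hg ha.1 ha.2
  rw [← hspan, hr, ncard_boxTruncation, Nat.add_right_cancel_iff] at hcount
  rw [hr, hcount]
  have : 9 * (2 * r + 1) ^ 2 = 4 * (9 * r ^ 2 + 9 * r + 1) + 5 := by ring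
  omega
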